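/- Let R be a regular commutative noetherian ring satisfying condition (††), let P be a finitely generated abelian group, and let A = R[x_1,…,x_n] be a polynomial R-algebra made into a P-graded R-algebra by declaring each variable x_i homogeneous of some degree λ_i ∈ P and R of degree 0 (a linear action of the diagonalizable group scheme G = Spec R[P]). Then every finitely generated P-graded A-module that is projective as an A-module is isomorphic, as a P-graded A-module, to F ⊗_R A for some P-graded R-module F that is finitely generated projective over R. -/

import Mathlib

open scoped TensorProduct

universe u

/-! ### Properties of commutative (additive) monoids -/

/-- `Q` is cancellative: `a + x = a + y → x = y`. -/
def IsCancellativeAddMonoid (Q : Type*) [AddCommMonoid Q] : Prop :=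
  ∀ a x y : Q, a + x = a + y → x = y

/-- `Q` is torsion-free: `n • x = n • y` for some `n > 0` implies `x = y`. -/
def IsTorsionFreeAddMonoid (Q : Type*) [AddCommMonoid Q] : Prop :=
  ∀ n : ℕ, 0 < n → ∀ x y : Q, n • x = n • y → x = y

/-- `Q` is seminormal: an element `x = a - b` of the Grothendieck group with
`2x, 3x ∈ Q` lies in `Q` (stated elementwise via representatives). -/
def IsSeminormalAddMonoid (Q : Type*) [AddCommMonoid Q] : Prop :=
  ∀ a b : Q, (∃ y : Q, a + a = b + b + y) → (∃ z : Q, a + a + a = b + b + b + z) →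
    ∃ w : Q, a = b + w

/-- `Q` is normal: an element `x = a - b` of the Grothendieck group with
`n • x ∈ Q` for some `n > 0` lies in `Q` (stated elementwise via representatives). -/
def IsNormalAddMonoid (Q : Type*) [AddCommMonoid Q] : Prop :=
  ∀ a b : Q, (∃ n : ℕ, 0 < n ∧ ∃ y : Q, n • a = n • b + y) → ∃ w : Q, a = b + w

/-- `Q` has no nontrivial unit: `x + y = 0 → x = 0`. -/
def HasNoNontrivialAddUnits (Q : Type*) [AddCommMonoid Q] : Prop :=
  ∀ x y : Q, x + y = 0 → x = 0

/-! ### Freeness/extension conditions on rings -/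

/-- Every (not necessarily finitely generated) projective `R`-module is free. -/
def AllProjectiveFree (R : Type u) [CommRing R] : Prop :=
  ∀ (M : Type u) [AddCommGroup M] [Module R M], Module.Projective R M → Module.Free R M

/-- Every finitely generated projective `B`-module is free. -/
def AllFGProjectiveFree (B : Type u) [CommRing B] : Prop :=
  ∀ (M : Type u) [AddCommGroup M] [Module B M],
    Module.Finite B M → Module.Projective B M → Module.Free B M

/-- Every finitely generated projective `B`-module is extended from `R`, i.e. of the form
`B ⊗_R F` for a finitely generated projective `R`-module `F`. -/
def AllFGProjectiveExtended (R B : Type u) [CommRing R] [CommRing B] [Algebra R B] : Prop :=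
  ∀ (M : Type u) [AddCommGroup M] [Module B M],
    Module.Finite B M → Module.Projective B M →
    ∃ (F : Type u) (_ : AddCommGroup F) (_ : Module R F),
      Module.Finite R F ∧ Module.Projective R F ∧ Nonempty (M ≃ₗ[B] B ⊗[R] F)

/-- Condition (†): every projective `R`-module is free and every finitely generated
projective module over the group algebra `R[Q]` of a torsion-free abelian group `Q`
is extended from `R`. -/
def CondDagger (R : Type u) [CommRing R] : Prop :=
  AllProjectiveFree R ∧
  ∀ (Q : Type u) [AddCommGroup Q], IsTorsionFreeAddMonoid Q →
    AllFGProjectiveExtended R (AddMonoidAlgebra R Q)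

/-- Condition (††): every projective `R`-module is free and every finitely generated
projective module over `R[Q × ℤ^n]` is extended from `R`, whenever `Q` is torsion-free,
seminormal, cancellative and has no nontrivial unit. -/
def CondDaggerDagger (R : Type u) [CommRing R] : Prop :=
  AllProjectiveFree R ∧
  ∀ (n : ℕ) (Q : Type u) [AddCommMonoid Q],
    IsCancellativeAddMonoid Q → IsTorsionFreeAddMonoid Q → IsSeminormalAddMonoid Q →
    HasNoNontrivialAddUnits Q →
    AllFGProjectiveExtended R (AddMonoidAlgebra R (Q × (Fin n → ℤ)))

/-! ### Gradings -/

/-- A map `f` is degree-preserving for the gradings `ℳ`, `𝒩`. -/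
def MapsGraded {P M N : Type*} {R : Type*} [Semiring R] [AddCommMonoid M] [AddCommMonoid N]
    [Module R M] [Module R N] (f : M → N)
    (ℳ : P → Submodule R M) (𝒩 : P → Submodule R N) : Prop :=
  ∀ c : P, ∀ m ∈ ℳ c, f m ∈ 𝒩 c

/-- `𝒜` is a `P`-grading of the `R`-algebra `A`:
`A = ⊕_{a ∈ P} A_a`, `A_a · A_b ⊆ A_{a+b}`, `1 ∈ A_0`. -/
structure IsGradedRing {R A P : Type*} [CommRing R] [Ring A] [Algebra R A]
    [AddCommGroup P] [DecidableEq P] (𝒜 : P → Submodule R A) : Prop where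
  is_internal : DirectSum.IsInternal 𝒜
  one_mem : (1 : A) ∈ 𝒜 0
  mul_mem : ∀ {a b : P} {x y : A}, x ∈ 𝒜 a → y ∈ 𝒜 b → x * y ∈ 𝒜 (a + b)

/-- `ℳ` is a `P`-grading of the `A`-module `M`, compatible with the grading `𝒜` of `A`:
`M = ⊕_{a ∈ P} M_a` and `A_a • M_b ⊆ M_{a+b}`. -/
structure IsGradedModule {R A P M : Type*} [CommRing R] [Ring A] [Algebra R A]
    [AddCommGroup P] [DecidableEq P] [AddCommGroup M] [Module R M] [Module A M]
    [IsScalarTower R A M] (𝒜 : P → Submodule R A) (ℳ : P → Submodule R M) : Prop where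
  is_internal : DirectSum.IsInternal ℳ
  smul_mem : ∀ {a b : P} {x : A} {m : M}, x ∈ 𝒜 a → m ∈ ℳ b → x • m ∈ ℳ (a + b)

/-- The natural `P`-grading on `B ⊗[R] F`: `(B ⊗ F)_c = ⊕_{a+b=c} B_a ⊗ F_b`. -/
noncomputable def tensorGrading {R B F P : Type*} [CommRing R] [CommRing B] [Algebra R B]
    [AddCommGroup P] [AddCommGroup F] [Module R F]
    (ℬ : P → Submodule R B) (ℱ : P → Submodule R F) : P → Submodule R (B ⊗[R] F) :=
  fun c => Submodule.span R
    {z | ∃ a b : P, a + b = c ∧ ∃ x ∈ ℬ a, ∃ f ∈ ℱ b, z = x ⊗ₜ[R] f}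

/-- A `P`-graded `A`-module `(M, ℳ)` is (equivariantly) extended from `R`, i.e. trivial:
it is isomorphic, as a `P`-graded `A`-module, to `A ⊗_R F` for some `P`-graded `R`-module
`F` which is finitely generated and projective over `R`. -/
def IsGradedExtendedFrom (R : Type u) {A P : Type u} [CommRing R] [CommRing A]
    [Algebra R A] [AddCommGroup P] [DecidableEq P] (𝒜 : P → Submodule R A)
    (M : Type u) [AddCommGroup M] [Module R M] [Module A M] [IsScalarTower R A M]
    (ℳ : P → Submodule R M) : Prop :=
  ∃ (F : Type u) (_ : AddCommGroup F) (_ : Module R F) (ℱ : P → Submodule R F),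
    DirectSum.IsInternal ℱ ∧ Module.Finite R F ∧ Module.Projective R F ∧
    ∃ e : M ≃ₗ[A] A ⊗[R] F,
      MapsGraded (⇑e) ℳ (tensorGrading 𝒜 ℱ) ∧ MapsGraded (⇑e.symm) (tensorGrading 𝒜 ℱ) ℳ

/-! ### Monoid algebras, cones and faces -/

/-- The grading of a monoid algebra `R[Λ]` induced by a degree function `deg : Λ → P`:
the piece of degree `p` is spanned by the monomials `e_s` with `deg s = p`. -/
noncomputable def monAlgGrading (R : Type*) [CommRing R] {Λ P : Type*} [AddCommMonoid Λ]
    (deg : Λ → P) : P → Submodule R (AddMonoidAlgebra R Λ) :=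
  fun p => Submodule.span R {x | ∃ s : Λ, deg s = p ∧ x = AddMonoidAlgebra.single s 1}

/-- The lattice points `σ ∩ L` of the rational polyhedral cone
`σ = ⋂ᵢ (l i)⁻¹(ℚ≥0)` in `L ⊗ ℚ`. -/
def coneLatticePoints {L : Type*} [AddCommGroup L] {q : ℕ} (l : Fin q → L →+ ℚ) :
    AddSubmonoid L where
  carrier := {m | ∀ i, 0 ≤ l i m}
  zero_mem' := fun i => by simp
  add_mem' := by
    intro a b ha hb i
    rw [map_add]
    exact add_nonneg (ha i) (hb i)

/-- The lattice points `τ ∩ L` of the face `τ = σ ∩ l'⁻¹(0)` of the cone `σ`. -/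
def faceLatticePoints {L : Type*} [AddCommGroup L] {q : ℕ} (l : Fin q → L →+ ℚ)
    (l' : L →+ ℚ) : AddSubmonoid L where
  carrier := {m | (∀ i, 0 ≤ l i m) ∧ l' m = 0}
  zero_mem' := ⟨fun i => by simp, by simp⟩
  add_mem' := by
    intro a b ha hb
    refine ⟨fun i => ?_, ?_⟩
    · rw [map_add]; exact add_nonneg (ha.1 i) (hb.1 i)
    · rw [map_add, ha.2, hb.2, add_zero]

/-- The submonoid of elements of a submonoid `S ⊆ L` killed by `ψ : L →+ P`
(the "invariant" part of `S`). -/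
def kerSubmonoidIn {L P : Type*} [AddCommMonoid L] [AddCommMonoid P]
    (S : AddSubmonoid L) (ψ : L →+ P) : AddSubmonoid L where
  carrier := {m | m ∈ S ∧ ψ m = 0}
  zero_mem' := ⟨S.zero_mem, map_zero ψ⟩
  add_mem' := by
    intro a b ha hb
    exact ⟨S.add_mem ha.1 hb.1, by rw [map_add, ha.2, hb.2, add_zero]⟩

/-- The kernel submonoid `{q ∈ Q | u q = 0}` of a monoid homomorphism `u : Q →+ P`. -/
def kerSubmonoid {Q P : Type*} [AddCommMonoid Q] [AddCommMonoid P] (u : Q →+ P) :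
    AddSubmonoid Q where
  carrier := {q | u q = 0}
  zero_mem' := map_zero u
  add_mem' := by
    intro a b ha hb
    simp only [Set.mem_setOf_eq] at *
    rw [map_add, ha, hb, add_zero]

/-- `S` spans `L ⊗ ℚ`: a positive multiple of every lattice element is a difference of
elements of `S` (this expresses that the cone is "strongly convex", i.e. spans `L_ℚ`). -/
def SpansLattice {L : Type*} [AddCommGroup L] (S : AddSubmonoid L) : Prop :=
  ∀ m : L, ∃ n : ℕ, 0 < n ∧ ∃ x ∈ S, ∃ y ∈ S, (n : ℤ) • m = x - y


/-- `R` is a regular local ring: it is noetherian, local, and its maximal ideal can be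
generated by (Krull dimension of `R`) many elements. -/
def IsRegularLocalRingP (R : Type u) [CommRing R] : Prop :=
  IsNoetherianRing R ∧
    ∃ _h : IsLocalRing R, ∃ s : Finset R,
      Ideal.span (s : Set R) = IsLocalRing.maximalIdeal R ∧
      (s.card : WithBot ℕ∞) = ringKrullDim R

/-- `R` is a regular ring: it is noetherian and all its localizations at primes are
regular local rings. -/
def IsRegularRingP (R : Type u) [CommRing R] : Prop :=
  IsNoetherianRing R ∧
  ∀ (p : Ideal R) (hp : p.IsPrime), IsRegularLocalRingP (@Localization.AtPrime R _ p hp)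

/-! ### Splitting idempotent matrices -/

/-- Every idempotent matrix over `C` factors through a free module of finite rank. -/
def IdempotentMatricesSplit (C : Type*) [CommRing C] : Prop :=
  ∀ (ι : Type) [Fintype ι] [DecidableEq ι] (E : Matrix ι ι C), E * E = E →
    ∃ (r : ℕ) (U : Matrix ι (Fin r) C) (V : Matrix (Fin r) ι C), U * V = E ∧ V * U = 1

section Transvections

variable {C : Type*} [CommRing C] {κ : Type*} [Fintype κ] [DecidableEq κ]

/-- One round of column operations raises the order of vanishing of the off-diagonal entries
of a matrix congruent to the identity. -/
lemma exists_column_operations_succ (J : Ideal C) {e : ℕ} (he : 1 ≤ e) (T : Matrix κ κ C)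
    (hT : ∀ i j, T i j - (1 : Matrix κ κ C) i j ∈ J) (hoff : ∀ i j, i ≠ j → T i j ∈ J ^ e)
    (W : Finset (κ × κ)) :
    ∃ h h' : Matrix κ κ C, h * h' = 1 ∧ h' * h = 1 ∧
      (∀ i j, (T * h) i j - (1 : Matrix κ κ C) i j ∈ J) ∧
      (∀ i j, i ≠ j → (T * h) i j ∈ J ^ e) ∧
      ∀ x ∈ W, x.1 ≠ x.2 → (T * h) x.1 x.2 ∈ J ^ (e + 1) := by
  induction W using Finset.induction_on with
  | empty => exact ⟨1, 1, by simp, by simp, by simpa using hT, by simpa using hoff, by simp⟩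
  | insert x W _ ih =>
    obtain ⟨h, h', h1, h2, h3, h4, h5⟩ := ih
    obtain ⟨i, j⟩ := x
    by_cases hij : i = j
    · refine ⟨h, h', h1, h2, h3, h4, fun y hy hne => ?_⟩
      rcases Finset.mem_insert.1 hy with rfl | hy
      · exact absurd hij hne
      · exact h5 y hy hne
    set S := T * h with hS
    have hJe : J ^ e ≤ J := Ideal.pow_le_self (by omega)
    have hJe1 : J ^ (e + 1) ≤ J ^ e := Ideal.pow_le_pow_right (by omega)
    have key : ∀ k l, (T * (h * Matrix.transvection i j (-(S i j)))) k l =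
        S k l - if l = j then S k i * S i j else 0 := by
      intro k l
      rw [← Matrix.mul_assoc, ← hS]
      split_ifs with hl
      · subst hl
        rw [Matrix.mul_transvection_apply_same]
        ring
      · rw [Matrix.mul_transvection_apply_of_ne _ _ _ _ hl, sub_zero]
    have hcorr : ∀ k, k ≠ i → S k i * S i j ∈ J ^ (e + 1) := fun k hk => by
      rw [add_comm, pow_add, pow_one]
      exact Ideal.mul_mem_mul (hJe (h4 k i hk)) (h4 i j hij)
    have hcorr' : ∀ k, S k i * S i j ∈ J ^ e := fun k =>
      Ideal.mul_mem_left _ _ (h4 i j hij)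
    refine ⟨h * Matrix.transvection i j (-(S i j)), Matrix.transvection i j (S i j) * h',
      ?_, ?_, ?_, ?_, ?_⟩
    · rw [Matrix.mul_assoc, ← Matrix.mul_assoc (Matrix.transvection _ _ _),
        Matrix.transvection_mul_transvection_same _ _ hij]
      simp [h1]
    · rw [Matrix.mul_assoc, ← Matrix.mul_assoc h', h2, Matrix.one_mul,
        Matrix.transvection_mul_transvection_same _ _ hij]
      simp
    · intro k l
      rw [key, sub_right_comm]
      refine J.sub_mem (h3 k l) ?_
      split_ifs
      · exact hJe (hcorr' k)
      · exact J.zero_mem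
    · intro k l hkl
      rw [key]
      refine Ideal.sub_mem _ (h4 k l hkl) ?_
      split_ifs
      · exact hcorr' k
      · exact Ideal.zero_mem _
    · intro y hy hne
      rw [key]
      split_ifs with hl
      · by_cases hk : y.1 = i
        · have : S y.1 y.2 - S y.1 i * S i j = -((S i i - (1 : Matrix κ κ C) i i) * S i j) := by
            rw [hl, hk, Matrix.one_apply_eq]
            ring
          rw [this, add_comm, pow_add, pow_one]
          exact neg_mem (Ideal.mul_mem_mul (h3 i i) (h4 i j hij))
        · refine Ideal.sub_mem _ ?_ (hcorr _ hk)
          rcases Finset.mem_insert.1 hy with hy | hy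
          · exact absurd (congrArg Prod.fst hy) hk
          · exact h5 y hy hne
      · rcases Finset.mem_insert.1 hy with hy | hy
        · exact absurd (congrArg Prod.snd hy) hl
        · simpa using h5 y hy hne

/-- A matrix congruent to the identity modulo `J` becomes diagonal modulo `J ^ e` after
invertible column operations. -/
lemma exists_column_operations (J : Ideal C) (e : ℕ) (T : Matrix κ κ C)
    (hT : ∀ i j, T i j - (1 : Matrix κ κ C) i j ∈ J) :
    ∃ h h' : Matrix κ κ C, h * h' = 1 ∧ h' * h = 1 ∧
      (∀ i j, (T * h) i j - (1 : Matrix κ κ C) i j ∈ J) ∧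
      ∀ i j, i ≠ j → (T * h) i j ∈ J ^ e := by
  have hoff : ∀ i j, i ≠ j → T i j ∈ J := fun i j hij => by
    simpa [Matrix.one_apply_ne hij] using hT i j
  induction e with
  | zero => exact ⟨1, 1, by simp, by simp, by simpa using hT, by simp⟩
  | succ e ih =>
    rcases Nat.eq_zero_or_pos e with rfl | he
    · exact ⟨1, 1, by simp, by simp, by simpa using hT, by simpa using hoff⟩
    obtain ⟨h, h', h1, h2, h3, h4⟩ := ih
    obtain ⟨g, g', g1, g2, g3, -, g5⟩ :=
      exists_column_operations_succ J he (T * h) h3 h4 Finset.univ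
    refine ⟨h * g, g' * h', ?_, ?_, ?_, ?_⟩
    · rw [Matrix.mul_assoc, ← Matrix.mul_assoc g, g1, Matrix.one_mul, h1]
    · rw [Matrix.mul_assoc, ← Matrix.mul_assoc h', h2, Matrix.one_mul, g2]
    · simpa only [← Matrix.mul_assoc] using g3
    · intro i j hij
      simpa only [← Matrix.mul_assoc] using g5 (i, j) (Finset.mem_univ _) hij

end Transvections

section Core

variable {C R : Type*} [CommRing C] [CommRing R]

lemma Matrix.mul_apply_mem_left {l m n : Type*} [Fintype m] (I : Ideal C) {X : Matrix l m C}
    (hX : ∀ i j, X i j ∈ I) (Y : Matrix m n C) (i : l) (k : n) : (X * Y) i k ∈ I := by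
  rw [Matrix.mul_apply]
  exact I.sum_mem fun j _ => I.mul_mem_right _ (hX i j)

lemma Matrix.mul_apply_mem_right {l m n : Type*} [Fintype m] (I : Ideal C) (X : Matrix l m C)
    {Y : Matrix m n C} (hY : ∀ i j, Y i j ∈ I) (i : l) (k : n) : (X * Y) i k ∈ I := by
  rw [Matrix.mul_apply]
  exact I.sum_mem fun j _ => I.mul_mem_left _ (hY j k)

/-- An idempotent matrix over an augmented ring all of whose idempotent matrices split, which is
congruent to a coordinate projection modulo a deep enough ideal `I`, has a splitting that is
diagonal modulo `I`. -/
lemma exists_splitting_diagonal_mod (aug : C →+* R) (sec : R →+* C)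
    (hsec : ∀ x, aug (sec x) = x) (hsplit : IdempotentMatricesSplit C) (I : Ideal C) (e : ℕ)
    (hI : RingHom.ker aug ^ e ≤ I) (hI' : I ≤ RingHom.ker aug)
    {ι : Type} [Fintype ι] [DecidableEq ι] (E : Matrix ι ι C) (hE : E * E = E)
    (ε : ι → Prop) [DecidablePred ε]
    (hEI : ∀ i j, E i j - Matrix.diagonal (fun i => if ε i then (1 : C) else 0) i j ∈ I) :
    ∃ (U : Matrix ι {i // ε i} C) (V : Matrix {i // ε i} ι C), U * V = E ∧ V * U = 1 ∧
      (∀ i j, i ≠ j.1 → U i j ∈ I) ∧ ∀ j i, j.1 ≠ i → V j i ∈ I := by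
  obtain ⟨r, U, V, hUV, hVU⟩ := hsplit ι E hE
  set J := RingHom.ker aug with hJ
  set τ := sec.comp aug with hτ
  have hτJ : ∀ x, x - τ x ∈ J := fun x => by
    rw [hJ, RingHom.mem_ker, map_sub, hτ, RingHom.comp_apply, hsec, sub_self]
  have hτI : ∀ x ∈ I, τ x = 0 := fun x hx => by
    rw [hτ, RingHom.comp_apply, RingHom.mem_ker.1 (hI' hx), map_zero]
  set Δ : Matrix ι ι C := Matrix.diagonal fun i => if ε i then (1 : C) else 0 with hΔ
  set L : Matrix ι {i // ε i} C := Matrix.of fun i j => if i = j.1 then 1 else 0 with hL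
  have hLt : L.transpose * L = 1 := by
    ext i j
    simp [hL, Matrix.mul_apply, Matrix.one_apply, Subtype.ext_iff, eq_comm]
  have hLL : L * L.transpose = Δ := by
    ext i j
    rw [Matrix.mul_apply, hΔ, Matrix.diagonal_apply]
    by_cases hi : ε i
    · rw [Finset.sum_eq_single ⟨i, hi⟩]
      · simp [hL, hi, eq_comm]
      · intro b _ hb
        have : i ≠ b.1 := fun h => hb (Subtype.ext h.symm)
        simp [hL, this]
      · simp
    · rw [Finset.sum_eq_zero]
      · simp [hi]
      · intro b _
        have : i ≠ b.1 := fun h => hi (h ▸ b.2)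
        simp [hL, this]
  have hΔL : Δ * L = L := by rw [← hLL, Matrix.mul_assoc, hLt, Matrix.mul_one]
  set U₀ := U.map τ with hU₀
  set V₀ := V.map τ with hV₀
  have hUV₀ : U₀ * V₀ = Δ := by
    rw [hU₀, hV₀, ← Matrix.map_mul, hUV]
    ext i j
    have h := hτI _ (hEI i j)
    rw [map_sub, sub_eq_zero] at h
    rw [Matrix.map_apply, h, hΔ, Matrix.diagonal_apply]
    split_ifs <;> simp
  have hVU₀ : V₀ * U₀ = 1 := by
    rw [hU₀, hV₀, ← Matrix.map_mul, hVU, Matrix.map_one _ (map_zero _) (map_one _)]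
  set U₁ := U * V₀ * L with hU₁
  set V₁ := L.transpose * U₀ * V with hV₁
  have hmid : V₀ * L * (L.transpose * U₀) = 1 := by
    calc V₀ * L * (L.transpose * U₀) = V₀ * (L * L.transpose) * U₀ := by
          simp only [Matrix.mul_assoc]
      _ = (V₀ * U₀) * (V₀ * U₀) := by rw [hLL, ← hUV₀]; simp only [Matrix.mul_assoc]
      _ = 1 := by rw [hVU₀, Matrix.one_mul]
  have hUV₁ : U₁ * V₁ = E := by
    calc U₁ * V₁ = U * (V₀ * L * (L.transpose * U₀)) * V := by
          simp only [hU₁, hV₁, Matrix.mul_assoc]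
      _ = E := by rw [hmid, Matrix.mul_one, hUV]
  have hVU₁ : V₁ * U₁ = 1 := by
    calc V₁ * U₁ = L.transpose * (U₀ * ((V * U) * V₀)) * L := by
          simp only [hU₁, hV₁, Matrix.mul_assoc]
      _ = 1 := by
          rw [hVU, Matrix.one_mul, hUV₀, Matrix.mul_assoc, hΔL, hLt]
  have hU₁J : ∀ i j, U₁ i j - L i j ∈ J := by
    intro i j
    have : U₁ - L = (U - U₀) * (V₀ * L) := by
      rw [Matrix.sub_mul, hU₁, ← Matrix.mul_assoc U₀, hUV₀, hΔL, Matrix.mul_assoc]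
    rw [← Matrix.sub_apply, this]
    exact Matrix.mul_apply_mem_left J (fun a b => hτJ (U a b)) _ i j
  obtain ⟨h, h', hh, hh', h3, h4⟩ := exists_column_operations J e (U₁.submatrix Subtype.val id)
    (fun i j => by simpa [hL, Matrix.one_apply, Subtype.ext_iff] using hU₁J i.1 j)
  set U₂ := U₁ * h with hU₂
  set V₂ := h' * V₁ with hV₂
  have hUV₂ : U₂ * V₂ = E := by
    rw [hU₂, hV₂, Matrix.mul_assoc, ← Matrix.mul_assoc h, hh, Matrix.one_mul, hUV₁]
  have hVU₂ : V₂ * U₂ = 1 := by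
    rw [hU₂, hV₂, Matrix.mul_assoc, ← Matrix.mul_assoc V₁, hVU₁, Matrix.one_mul, hh']
  have hsub : ∀ i j : {i // ε i}, (U₁.submatrix Subtype.val id * h) i j = U₂ i.1 j := fun i j => by
    simp [hU₂, Matrix.mul_apply]
  have hU : ∀ i j, i ≠ j.1 → U₂ i j ∈ I := by
    intro i j hij
    by_cases hi : ε i
    · rw [← hsub ⟨i, hi⟩ j]
      exact hI (h4 _ _ fun h => hij (congrArg Subtype.val h))
    · have h1 : U₂ - Δ * U₂ = (E - Δ) * U₂ := by
        rw [Matrix.sub_mul, ← hUV₂, Matrix.mul_assoc, hVU₂, Matrix.mul_one]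
      have h2 : (U₂ - Δ * U₂) i j = U₂ i j := by simp [hΔ, Matrix.diagonal_mul, hi]
      rw [← h2, h1]
      exact Matrix.mul_apply_mem_left I hEI _ i j
  refine ⟨U₂, V₂, hUV₂, hVU₂, hU, fun j i hji => ?_⟩
  by_cases hi : ε i
  · have hne : j ≠ ⟨i, hi⟩ := fun h => hji (congrArg Subtype.val h)
    have h1 : V₂ j i * U₂ i ⟨i, hi⟩ ∈ I := by
      have h0 : (V₂ * U₂) j ⟨i, hi⟩ = 0 := by rw [hVU₂, Matrix.one_apply_ne hne]
      rw [Matrix.mul_apply, ← Finset.add_sum_erase _ _ (Finset.mem_univ i)] at h0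
      rw [eq_neg_of_add_eq_zero_left h0]
      exact neg_mem (I.sum_mem fun l hl =>
        I.mul_mem_left _ (hU l _ (Finset.ne_of_mem_erase hl)))
    set d := U₂ i ⟨i, hi⟩ with hd
    have hd1 : (1 - d) ^ e ∈ I := by
      refine hI (Ideal.pow_mem_pow ?_ e)
      have := h3 ⟨i, hi⟩ ⟨i, hi⟩
      rw [hsub, Matrix.one_apply_eq] at this
      rw [← neg_sub]
      exact neg_mem this
    obtain ⟨c, hc⟩ : d ∣ 1 - (1 - d) ^ e := by
      simpa using sub_dvd_pow_sub_pow 1 (1 - d) e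
    have : V₂ j i = V₂ j i * d * c + V₂ j i * (1 - d) ^ e := by
      rw [mul_assoc, ← hc]
      ring
    rw [this]
    exact I.add_mem (I.mul_mem_right _ h1) (I.mul_mem_left _ hd1)
  · have h1 : V₂ - V₂ * Δ = V₂ * (E - Δ) := by
      rw [Matrix.mul_sub, ← hUV₂, ← Matrix.mul_assoc, hVU₂, Matrix.one_mul]
    have h2 : (V₂ - V₂ * Δ) j i = V₂ j i := by simp [hΔ, Matrix.mul_diagonal, hi]
    rw [← h2, h1]
    exact Matrix.mul_apply_mem_right I _ hEI j i

end Core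

section ConditionDaggerDagger

/-- Idempotent matrices over `B` split if the finitely generated projective `B`-modules are
extended from a ring over which projective modules are free. -/
lemma AllFGProjectiveExtended.idempotentMatricesSplit {R B : Type u} [CommRing R] [CommRing B]
    [Algebra R B] (hfree : AllProjectiveFree R) (hext : AllFGProjectiveExtended R B) :
    IdempotentMatricesSplit B := by
  intro ι _ _ E hE
  set f : (ι → B) →ₗ[B] (ι → B) := Matrix.toLin' E with hf
  have hff : ∀ x, f (f x) = f x := fun x => by
    rw [hf, ← LinearMap.comp_apply, ← Matrix.toLin'_mul, hE]
  set π : (ι → B) →ₗ[B] LinearMap.range f := f.rangeRestrict with hπ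
  have hπ' : ∀ x : LinearMap.range f, π x.1 = x := by
    rintro ⟨_, y, rfl⟩
    exact Subtype.ext (hff y)
  have hsect : π ∘ₗ (LinearMap.range f).subtype = LinearMap.id := LinearMap.ext hπ'
  have hproj : Module.Projective B (LinearMap.range f) :=
    Module.Projective.of_split _ _ hsect
  obtain ⟨F, _, _, _, hF, ⟨φ⟩⟩ := hext (LinearMap.range f) inferInstance hproj
  have : Module.Free R F := hfree F hF
  let b := Module.Free.chooseBasis R F
  let w := Fintype.equivFin (Module.Free.ChooseBasisIndex R F)
  let bB : Module.Basis (Fin (Fintype.card (Module.Free.ChooseBasisIndex R F))) B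
      (LinearMap.range f) := ((Algebra.TensorProduct.basis B b).map φ.symm).reindex w
  let g := bB.equivFun
  refine ⟨_, LinearMap.toMatrix' ((LinearMap.range f).subtype ∘ₗ g.symm.toLinearMap),
    LinearMap.toMatrix' (g.toLinearMap ∘ₗ π), ?_, ?_⟩
  · rw [← LinearMap.toMatrix'_comp]
    have : ((LinearMap.range f).subtype ∘ₗ g.symm.toLinearMap) ∘ₗ (g.toLinearMap ∘ₗ π) = f := by
      ext x
      simp [hπ]
    rw [this, hf, LinearMap.toMatrix'_toLin']
  · rw [← LinearMap.toMatrix'_comp]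
    have : (g.toLinearMap ∘ₗ π) ∘ₗ ((LinearMap.range f).subtype ∘ₗ g.symm.toLinearMap) =
        LinearMap.id := by
      refine LinearMap.ext fun x => ?_
      simp only [LinearMap.comp_apply, Submodule.subtype_apply, LinearEquiv.coe_coe, hπ',
        LinearEquiv.apply_symm_apply, LinearMap.id_apply]
    rw [this, LinearMap.toMatrix'_id]

lemma IdempotentMatricesSplit.of_ringEquiv {C D : Type*} [CommRing C] [CommRing D] (φ : C ≃+* D)
    (hD : IdempotentMatricesSplit D) : IdempotentMatricesSplit C := by
  intro ι _ _ E hE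
  obtain ⟨r, U, V, hUV, hVU⟩ := hD ι (E.map φ) (by rw [← Matrix.map_mul, hE])
  refine ⟨r, U.map φ.symm, V.map φ.symm, ?_, ?_⟩
  · rw [← Matrix.map_mul, hUV]
    ext
    simp
  · rw [← Matrix.map_mul, hVU, Matrix.map_one _ (map_zero _) (map_one _)]

lemma CondDaggerDagger.idempotentMatricesSplit {R : Type u} [CommRing R]
    (hR : CondDaggerDagger R) (Q : Type) [AddCommMonoid Q]
    (hc : IsCancellativeAddMonoid Q) (ht : IsTorsionFreeAddMonoid Q)
    (hs : IsSeminormalAddMonoid Q) (hu : HasNoNontrivialAddUnits Q) :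
    IdempotentMatricesSplit (AddMonoidAlgebra R Q) := by
  let ψ : Q ≃+ ULift.{u} Q × (Fin 0 → ℤ) :=
    AddEquiv.ulift.symm.trans (AddEquiv.prodUnique (M := ULift.{u} Q) (N := Fin 0 → ℤ)).symm
  refine IdempotentMatricesSplit.of_ringEquiv (AddMonoidAlgebra.mapDomainRingEquiv R ψ)
    (AllFGProjectiveExtended.idempotentMatricesSplit hR.1 (hR.2 0 (ULift.{u} Q) ?_ ?_ ?_ ?_))
  · intro a x y h
    exact ULift.ext _ _ (hc a.down x.down y.down (congrArg ULift.down h))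
  · intro n hn x y h
    exact ULift.ext _ _ (ht n hn x.down y.down (congrArg ULift.down h))
  · rintro a b ⟨y, hy⟩ ⟨z, hz⟩
    obtain ⟨w, hw⟩ := hs a.down b.down ⟨y.down, congrArg ULift.down hy⟩
      ⟨z.down, congrArg ULift.down hz⟩
    exact ⟨⟨w⟩, ULift.ext _ _ hw⟩
  · intro x y h
    exact ULift.ext _ _ (hu x.down y.down (congrArg ULift.down h))

end ConditionDaggerDagger

/-! ### Supports of elements of monoid algebras -/

section Support

variable (R : Type*) [CommRing R] {Q : Type*}

/-- The elements of `R[Q]` supported in `S`. -/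
def suppIn (S : Set Q) : Submodule R (AddMonoidAlgebra R Q) where
  carrier := {f | ∀ c, f.coeff c ≠ 0 → c ∈ S}
  zero_mem' c h := absurd rfl h
  add_mem' {f g} hf hg c h := by
    by_cases hc : f.coeff c = 0
    · exact hg c fun hg' => h (by simp [hc, hg'])
    · exact hf c hc
  smul_mem' r f hf c h := hf c fun hc => h (by simp [hc])

variable {R}

lemma single_mem_suppIn {S : Set Q} {c : Q} (hc : c ∈ S) (r : R) :
    AddMonoidAlgebra.single c r ∈ suppIn R S := by
  classical
  intro d hd
  rw [AddMonoidAlgebra.coeff_single, Finsupp.single_apply] at hd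
  split_ifs at hd with h
  · exact h ▸ hc
  · exact absurd rfl hd

variable [AddCommMonoid Q]

lemma mul_mem_suppIn {S T U : Set Q} (h : ∀ a ∈ S, ∀ b ∈ T, a + b ∈ U)
    {f g : AddMonoidAlgebra R Q} (hf : f ∈ suppIn R S) (hg : g ∈ suppIn R T) :
    f * g ∈ suppIn R U := by
  classical
  intro c hc
  have := AddMonoidAlgebra.support_coeff_mul_subset f g (Finsupp.mem_support_iff.2 hc)
  obtain ⟨a, ha, b, hb, rfl⟩ := Finset.mem_add.1 this
  exact h a (hf a (Finsupp.mem_support_iff.1 ha)) b (hg b (Finsupp.mem_support_iff.1 hb))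

lemma suppIn_eq_span (S : Set Q) :
    suppIn R S = Submodule.span R {x | ∃ c ∈ S, x = AddMonoidAlgebra.single c 1} := by
  refine le_antisymm (fun f hf => ?_) (Submodule.span_le.2 ?_)
  · rw [← AddMonoidAlgebra.sum_coeff_single f]
    refine Submodule.sum_mem _ fun c hc => ?_
    have : AddMonoidAlgebra.single c (f.coeff c) =
        f.coeff c • AddMonoidAlgebra.single c (1 : R) := by
      simp
    rw [this]
    exact Submodule.smul_mem _ _
      (Submodule.subset_span ⟨c, hf c (Finsupp.mem_support_iff.1 hc), rfl⟩)
  · rintro _ ⟨c, hc, rfl⟩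
    exact single_mem_suppIn hc 1

/-- The ideal of `R[Q]` of elements supported in an ideal `S` of the monoid `Q`. -/
def suppIdeal (R : Type*) [CommRing R] (S : Set Q) (hS : ∀ a, ∀ b ∈ S, a + b ∈ S) :
    Ideal (AddMonoidAlgebra R Q) where
  carrier := suppIn R S
  zero_mem' := zero_mem _
  add_mem' := add_mem
  smul_mem' _ _ hg := mul_mem_suppIn (S := Set.univ) (fun a _ => hS a) (fun _ _ => trivial) hg

open Classical in
/-- The retraction of `R[Q]` onto the subalgebra of a face `F` of `Q`. -/
noncomputable def faceRetraction (R : Type*) [CommRing R] (F : AddSubmonoid Q)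
    (hF : ∀ x y, x + y ∈ F → x ∈ F ∧ y ∈ F) : AddMonoidAlgebra R Q →+* AddMonoidAlgebra R Q :=
  AddMonoidAlgebra.liftNCRingHom AddMonoidAlgebra.singleZeroRingHom
    { toFun := fun c => if c.toAdd ∈ F then AddMonoidAlgebra.single c.toAdd 1 else 0
      map_one' := by simp [AddMonoidAlgebra.one_def, F.zero_mem]
      map_mul' := fun x y => by
        by_cases hx : x.toAdd ∈ F <;> by_cases hy : y.toAdd ∈ F
        · simp [hx, hy, F.add_mem hx hy, AddMonoidAlgebra.single_mul_single]
        all_goals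
          have hxy : x.toAdd + y.toAdd ∉ F := fun h => by simp_all [hF _ _ h]
          simp [hx, hy, hxy] }
    fun _ _ => Commute.all _ _

open Classical in
lemma coeff_faceRetraction (F : AddSubmonoid Q) (hF : ∀ x y, x + y ∈ F → x ∈ F ∧ y ∈ F)
    (f : AddMonoidAlgebra R Q) (c : Q) :
    (faceRetraction R F hF f).coeff c = if c ∈ F then f.coeff c else 0 := by
  induction f using AddMonoidAlgebra.induction_linear with
  | zero => simp
  | add f g hf hg =>
    rw [map_add, AddMonoidAlgebra.coeff_add, Finsupp.add_apply, hf, hg]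
    split_ifs <;> simp
  | single d r =>
    rw [faceRetraction, AddMonoidAlgebra.liftNCRingHom_single]
    by_cases hd : d ∈ F
    · by_cases hdc : d = c
      · subst hdc
        simp [hd, AddMonoidAlgebra.single_mul_single]
      · simp [hd, hdc, AddMonoidAlgebra.single_mul_single]
    · by_cases hdc : d = c
      · subst hdc
        simp [hd]
      · simp [hd, hdc]

lemma exists_mapDomain_eq {Q' : Type*} [AddCommMonoid Q'] (φ : Q →+ Q')
    (hφ : Function.Injective φ) (f : AddMonoidAlgebra R Q')
    (hf : f ∈ suppIn R (Set.range φ)) :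
    ∃ g : AddMonoidAlgebra R Q, AddMonoidAlgebra.mapDomainRingHom R φ g = f :=
  ⟨f.comapDomain φ hφ, AddMonoidAlgebra.mapDomain_comapDomain
    (fun c hc => hf c (Finsupp.mem_support_iff.1 hc)) _⟩

lemma mapDomain_mem_suppIn_iff {Q' : Type*} [AddCommMonoid Q'] (φ : Q →+ Q')
    (hφ : Function.Injective φ) (f : AddMonoidAlgebra R Q) (S : Set Q') :
    AddMonoidAlgebra.mapDomainRingHom R φ f ∈ suppIn R S ↔ f ∈ suppIn R (φ ⁻¹' S) := by
  constructor
  · intro h c hc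
    refine h (φ c) ?_
    simpa [Finsupp.mapDomain_apply hφ] using hc
  · intro h c hc
    by_cases hc' : c ∈ Set.range φ
    · obtain ⟨d, rfl⟩ := hc'
      refine h d ?_
      simpa [Finsupp.mapDomain_apply hφ] using hc
    · refine absurd ?_ hc
      simp [Finsupp.mapDomain_of_notMem_range _ _ hc']

end Support

/-! ### Homogeneous matrices over a polynomial ring -/

section Homogeneous

variable {R : Type*} [CommRing R] {σ P : Type*} [Fintype σ] [AddCommGroup P] (lam : σ → P)

/-- The exponents of the monomials of degree `d` in the variables indexed by `s`. -/
def exponents (s : Finset σ) (d : P) : Set (σ → ℕ) :=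
  {c | ∑ i, c i • lam i = d ∧ ∀ i ∉ s, c i = 0}

variable {lam}

lemma zero_mem_exponents {s : Finset σ} : (0 : σ → ℕ) ∈ exponents lam s 0 := by
  simp [exponents]

lemma add_mem_exponents {s : Finset σ} {a b : P} {c d : σ → ℕ} (hc : c ∈ exponents lam s a)
    (hd : d ∈ exponents lam s b) : c + d ∈ exponents lam s (a + b) := by
  refine ⟨?_, fun i hi => by simp [hc.2 i hi, hd.2 i hi]⟩
  simp [add_smul, Finset.sum_add_distrib, hc.1, hd.1]

variable {ι κ μ : Type*} {s : Finset σ} {p : ι → P} {q : κ → P} {r : μ → P}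

variable (lam s p q) in
/-- The matrices that define a degree-preserving map between the graded free modules with basis
elements in degrees `q` and `p`, with entries in the subring generated by the variables in `s`. -/
def Matrix.IsHomog (X : Matrix ι κ (AddMonoidAlgebra R (σ → ℕ))) : Prop :=
  ∀ i j, X i j ∈ suppIn R (exponents lam s (q j - p i))

namespace Matrix.IsHomog

lemma mul [Fintype κ] {X : Matrix ι κ (AddMonoidAlgebra R (σ → ℕ))}
    {Y : Matrix κ μ (AddMonoidAlgebra R (σ → ℕ))} (hX : X.IsHomog lam s p q)
    (hY : Y.IsHomog lam s q r) : (X * Y).IsHomog lam s p r := fun i j => by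
  rw [Matrix.mul_apply]
  refine Submodule.sum_mem _ fun k _ => mul_mem_suppIn (fun a ha b hb => ?_) (hX i k) (hY k j)
  simpa using add_mem_exponents ha hb

lemma add {X Y : Matrix ι κ (AddMonoidAlgebra R (σ → ℕ))} (hX : X.IsHomog lam s p q)
    (hY : Y.IsHomog lam s p q) : (X + Y).IsHomog lam s p q :=
  fun i j => Submodule.add_mem _ (hX i j) (hY i j)

lemma sub {X Y : Matrix ι κ (AddMonoidAlgebra R (σ → ℕ))} (hX : X.IsHomog lam s p q)
    (hY : Y.IsHomog lam s p q) : (X - Y).IsHomog lam s p q :=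
  fun i j => Submodule.sub_mem _ (hX i j) (hY i j)

lemma one [DecidableEq ι] :
    (1 : Matrix ι ι (AddMonoidAlgebra R (σ → ℕ))).IsHomog lam s p p := fun i j => by
  rw [Matrix.one_apply]
  split_ifs with h
  · subst h
    rw [sub_self, AddMonoidAlgebra.one_def]
    exact single_mem_suppIn zero_mem_exponents 1
  · exact Submodule.zero_mem _

lemma pow [Fintype ι] [DecidableEq ι] {X : Matrix ι ι (AddMonoidAlgebra R (σ → ℕ))}
    (hX : X.IsHomog lam s p p) : ∀ a : ℕ, (X ^ a).IsHomog lam s p p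
  | 0 => by simpa using one
  | a + 1 => by
    rw [pow_succ]
    exact (hX.pow a).mul hX

lemma sum {α : Type*} (w : Finset α) {X : α → Matrix ι κ (AddMonoidAlgebra R (σ → ℕ))}
    (hX : ∀ a ∈ w, (X a).IsHomog lam s p q) : (∑ a ∈ w, X a).IsHomog lam s p q := fun i j => by
  rw [Matrix.sum_apply]
  exact Submodule.sum_mem _ fun a ha => hX a ha i j

lemma mono {t : Finset σ} (hst : s ⊆ t) {X : Matrix ι κ (AddMonoidAlgebra R (σ → ℕ))}
    (hX : X.IsHomog lam s p q) : X.IsHomog lam t p q :=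
  fun i j c hc => ⟨(hX i j c hc).1, fun k hk => (hX i j c hc).2 k fun h => hk (hst h)⟩

end Matrix.IsHomog

variable (lam s p) in
/-- The homogeneous matrix `E` is the projection onto a graded free direct summand. -/
def Matrix.GradedSplits [Fintype ι] (E : Matrix ι ι (AddMonoidAlgebra R (σ → ℕ))) : Prop :=
  ∃ (κ : Type) (_ : Fintype κ) (_ : DecidableEq κ) (q : κ → P)
    (X : Matrix ι κ (AddMonoidAlgebra R (σ → ℕ))) (Y : Matrix κ ι (AddMonoidAlgebra R (σ → ℕ))),
    X.IsHomog lam s p q ∧ Y.IsHomog lam s q p ∧ X * Y = E ∧ Y * X = 1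

end Homogeneous

/-! ### Gluing splittings along the coordinate hyperplanes -/

section Boundary

lemma Matrix.map_mk_eq_iff {C ι κ : Type*} [CommRing C] {I : Ideal C} {X Y : Matrix ι κ C} :
    X.map (Ideal.Quotient.mk I) = Y.map (Ideal.Quotient.mk I) ↔ ∀ i j, X i j - Y i j ∈ I := by
  simp only [← Matrix.ext_iff, Matrix.map_apply, Ideal.Quotient.eq]

variable {R : Type*} [CommRing R] {σ P : Type*} [AddCommGroup P] {lam : σ → P}

/-- The ideal generated by the monomials divisible by the `a`-th powers of the variables
indexed by `t`. -/
def vanishingIdeal (R : Type*) [CommRing R] (t : Finset σ) (a : ℕ) :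
    Ideal (AddMonoidAlgebra R (σ → ℕ)) :=
  suppIdeal R {c | ∀ k ∈ t, a ≤ c k} fun _ _ hb k hk => (hb k hk).trans (Nat.le_add_left _ _)

/-- Setting the variable with index `k` to zero. -/
noncomputable def setZero (R : Type*) [CommRing R] (k : σ) :
    AddMonoidAlgebra R (σ → ℕ) →+* AddMonoidAlgebra R (σ → ℕ) :=
  faceRetraction R (AddMonoidHom.mker (Pi.evalAddMonoidHom (fun _ : σ => ℕ) k)) fun x y h => by
    simpa [AddMonoidHom.mem_mker] using h

lemma coeff_setZero (k : σ) (f : AddMonoidAlgebra R (σ → ℕ)) (c : σ → ℕ) :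
    (setZero R k f).coeff c = if c k = 0 then f.coeff c else 0 := by
  rw [setZero, coeff_faceRetraction]
  simp [AddMonoidHom.mem_mker]

lemma setZero_mem_suppIn {S : Set (σ → ℕ)} {k : σ} {f : AddMonoidAlgebra R (σ → ℕ)}
    (hf : f ∈ suppIn R S) : setZero R k f ∈ suppIn R {c | c ∈ S ∧ c k = 0} := by
  intro c hc
  rw [coeff_setZero] at hc
  split_ifs at hc with h
  · exact ⟨hf c hc, h⟩
  · exact absurd rfl hc

lemma setZero_eq_self {k : σ} {f : AddMonoidAlgebra R (σ → ℕ)}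
    (hf : f ∈ suppIn R {c | c k = 0}) : setZero R k f = f := by
  refine AddMonoidAlgebra.coeff_injective (Finsupp.ext fun c => ?_)
  rw [coeff_setZero]
  split_ifs with h
  · rfl
  · by_contra hc
    exact h (hf c (Ne.symm hc))

lemma setZero_sub_self_mem (k : σ) (f : AddMonoidAlgebra R (σ → ℕ)) :
    setZero R k f - f ∈ vanishingIdeal R {k} 1 := by
  intro c hc
  rw [AddMonoidAlgebra.coeff_sub, Finsupp.sub_apply, coeff_setZero] at hc
  split_ifs at hc with h
  · exact absurd (sub_self _) hc
  · simpa [Nat.one_le_iff_ne_zero] using h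

variable {ι κ : Type*}

lemma map_setZero_map_mk (k : σ) (X : Matrix ι κ (AddMonoidAlgebra R (σ → ℕ))) :
    (X.map (setZero R k)).map (Ideal.Quotient.mk (vanishingIdeal R {k} 1)) =
      X.map (Ideal.Quotient.mk (vanishingIdeal R {k} 1)) :=
  Matrix.map_mk_eq_iff.2 fun i j => setZero_sub_self_mem k (X i j)

lemma map_setZero_map_setZero (k : σ) (X : Matrix ι κ (AddMonoidAlgebra R (σ → ℕ))) :
    (X.map (setZero R k)).map (setZero R k) = X.map (setZero R k) := by
  refine Matrix.ext fun i j => setZero_eq_self ?_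
  exact fun c hc => (setZero_mem_suppIn (S := Set.univ) (fun _ _ => trivial) c hc).2

lemma map_setZero_map_mk_congr (k : σ) {t : Finset σ} {a : ℕ}
    {X Y : Matrix ι κ (AddMonoidAlgebra R (σ → ℕ))}
    (h : X.map (Ideal.Quotient.mk (vanishingIdeal R t a)) =
      Y.map (Ideal.Quotient.mk (vanishingIdeal R t a))) :
    (X.map (setZero R k)).map (Ideal.Quotient.mk (vanishingIdeal R t a)) =
      (Y.map (setZero R k)).map (Ideal.Quotient.mk (vanishingIdeal R t a)) := by
  rw [Matrix.map_mk_eq_iff] at h ⊢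
  intro i j
  rw [Matrix.map_apply, Matrix.map_apply, ← map_sub]
  exact fun c hc => (setZero_mem_suppIn (h i j) c hc).1

lemma map_mk_insert [DecidableEq σ] {k : σ} {t : Finset σ} {a : ℕ}
    {X Y : Matrix ι κ (AddMonoidAlgebra R (σ → ℕ))}
    (hk : X.map (Ideal.Quotient.mk (vanishingIdeal R {k} a)) =
      Y.map (Ideal.Quotient.mk (vanishingIdeal R {k} a)))
    (ht : X.map (Ideal.Quotient.mk (vanishingIdeal R t a)) =
      Y.map (Ideal.Quotient.mk (vanishingIdeal R t a))) :
    X.map (Ideal.Quotient.mk (vanishingIdeal R (insert k t) a)) =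
      Y.map (Ideal.Quotient.mk (vanishingIdeal R (insert k t) a)) := by
  rw [Matrix.map_mk_eq_iff] at hk ht ⊢
  intro i j c hc l hl
  rcases Finset.mem_insert.1 hl with rfl | hl
  · exact hk i j c hc l (Finset.mem_singleton_self l)
  · exact ht i j c hc l hl

variable [Fintype σ] [DecidableEq σ] {s : Finset σ} {p : ι → P} {q : κ → P}

lemma Matrix.IsHomog.map_setZero {X : Matrix ι κ (AddMonoidAlgebra R (σ → ℕ))}
    (hX : X.IsHomog lam s p q) (k : σ) : (X.map (setZero R k)).IsHomog lam (s.erase k) p q := by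
  intro i j c hc
  obtain ⟨⟨h1, h2⟩, h3⟩ := setZero_mem_suppIn (hX i j) c hc
  refine ⟨h1, fun l hl => ?_⟩
  by_cases hlk : l = k
  · exact hlk ▸ h3
  · exact h2 l fun h => hl (Finset.mem_erase.2 ⟨hlk, h⟩)

lemma Matrix.IsHomog.map_setZero_eq_self {k : σ} {X : Matrix ι κ (AddMonoidAlgebra R (σ → ℕ))}
    (hX : X.IsHomog lam (s.erase k) p q) : X.map (setZero R k) = X := by
  exact Matrix.ext fun i j => setZero_eq_self fun c hc =>
    (hX i j c hc).2 k (Finset.notMem_erase k s)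

/-- If homogeneous idempotent matrices in fewer variables split, then a homogeneous idempotent
matrix splits on any union of coordinate hyperplanes. -/
lemma exists_splitting_mod_boundary
    (ih : ∀ k ∈ s, ∀ (ι : Type) [Fintype ι] [DecidableEq ι] (p : ι → P)
      (E : Matrix ι ι (AddMonoidAlgebra R (σ → ℕ))), E * E = E →
      E.IsHomog lam (s.erase k) p p → E.GradedSplits lam (s.erase k) p)
    {ι : Type} [Fintype ι] [DecidableEq ι] {p : ι → P}
    {E : Matrix ι ι (AddMonoidAlgebra R (σ → ℕ))} (hE : E * E = E) (hEh : E.IsHomog lam s p p)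
    (t : Finset σ) (hts : t ⊆ s) :
    ∃ (κ : Type) (_ : Fintype κ) (_ : DecidableEq κ) (q : κ → P)
      (X : Matrix ι κ (AddMonoidAlgebra R (σ → ℕ))) (Y : Matrix κ ι (AddMonoidAlgebra R (σ → ℕ))),
      X.IsHomog lam s p q ∧ Y.IsHomog lam s q p ∧
      (X * Y).map (Ideal.Quotient.mk (vanishingIdeal R t 1)) =
        E.map (Ideal.Quotient.mk (vanishingIdeal R t 1)) ∧
      (Y * X).map (Ideal.Quotient.mk (vanishingIdeal R t 1)) =
        (1 : Matrix κ κ _).map (Ideal.Quotient.mk (vanishingIdeal R t 1)) := by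
  induction t using Finset.induction_on with
  | empty =>
    refine ⟨Fin 0, inferInstance, inferInstance, finZeroElim, 0, 0, fun i j => j.elim0,
      fun i => i.elim0, Matrix.map_mk_eq_iff.2 fun i j c hc k hk => ?_,
      Matrix.map_mk_eq_iff.2 fun i => i.elim0⟩
    exact absurd hk (Finset.notMem_empty k)
  | insert k t _ iht =>
    obtain ⟨κ, _, _, q, X, Y, hX, hY, hXY, hYX⟩ :=
      iht ((Finset.subset_insert k t).trans hts)
    obtain ⟨κ', _, _, q', X', Y', hX', hY', hXY', hYX'⟩ :=
      ih k (hts (Finset.mem_insert_self k t)) ι p (E.map (setZero R k))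
        (by rw [← Matrix.map_mul, hE]) (hEh.map_setZero k)
    have hsub := Finset.erase_subset k s
    set ζ := setZero R k with hζ
    set π := Ideal.Quotient.mk (vanishingIdeal R t 1) with hπ
    set X₁ := X * (Y.map ζ * X') with hX₁
    set Y₁ := Y' * X.map ζ * Y with hY₁
    have hX₁h : X₁.IsHomog lam s p q' :=
      hX.mul (((hY.map_setZero k).mono hsub).mul (hX'.mono hsub))
    have hY₁h : Y₁.IsHomog lam s q' p :=
      ((hY'.mono hsub).mul ((hX.map_setZero k).mono hsub)).mul hY
    have hXYζ : (X.map ζ * Y.map ζ).map π = (E.map ζ).map π := by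
      rw [← Matrix.map_mul]
      exact map_setZero_map_mk_congr k hXY
    have hX₁ζ : (X₁.map ζ).map π = X'.map π := by
      have : X₁.map ζ = X.map ζ * Y.map ζ * X' := by
        rw [hX₁, Matrix.map_mul, Matrix.map_mul, hζ, map_setZero_map_setZero,
          hX'.map_setZero_eq_self, Matrix.mul_assoc]
      rw [this, Matrix.map_mul, hXYζ, ← hXY', ← Matrix.map_mul, Matrix.mul_assoc, hYX',
        Matrix.mul_one]
    have hY₁ζ : (Y₁.map ζ).map π = Y'.map π := by
      have : Y₁.map ζ = Y' * (X.map ζ * Y.map ζ) := by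
        rw [hY₁, Matrix.map_mul, Matrix.map_mul, hζ, map_setZero_map_setZero,
          hY'.map_setZero_eq_self, Matrix.mul_assoc]
      rw [this, Matrix.map_mul, hXYζ, ← hXY', ← Matrix.map_mul, ← Matrix.mul_assoc, hYX',
        Matrix.one_mul]
    have hX₂t : (X' + (X₁ - X₁.map ζ)).map π = X₁.map π := by
      rw [Matrix.map_add _ (map_add π), Matrix.map_sub _ (map_sub π), hX₁ζ, add_sub_cancel]
    have hY₂t : (Y' + (Y₁ - Y₁.map ζ)).map π = Y₁.map π := by
      rw [Matrix.map_add _ (map_add π), Matrix.map_sub _ (map_sub π), hY₁ζ, add_sub_cancel]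
    have hX₂k : (X' + (X₁ - X₁.map ζ)).map (Ideal.Quotient.mk (vanishingIdeal R {k} 1)) =
        X'.map (Ideal.Quotient.mk (vanishingIdeal R {k} 1)) := by
      rw [Matrix.map_add _ (map_add _), Matrix.map_sub _ (map_sub _), map_setZero_map_mk,
        sub_self, add_zero]
    have hY₂k : (Y' + (Y₁ - Y₁.map ζ)).map (Ideal.Quotient.mk (vanishingIdeal R {k} 1)) =
        Y'.map (Ideal.Quotient.mk (vanishingIdeal R {k} 1)) := by
      rw [Matrix.map_add _ (map_add _), Matrix.map_sub _ (map_sub _), map_setZero_map_mk,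
        sub_self, add_zero]
    refine ⟨κ', inferInstance, inferInstance, q', X' + (X₁ - X₁.map ζ), Y' + (Y₁ - Y₁.map ζ),
      (hX'.mono hsub).add (hX₁h.sub ((hX₁h.map_setZero k).mono hsub)),
      (hY'.mono hsub).add (hY₁h.sub ((hY₁h.map_setZero k).mono hsub)),
      map_mk_insert ?_ ?_, map_mk_insert ?_ ?_⟩
    · rw [Matrix.map_mul, hX₂k, hY₂k, ← Matrix.map_mul, hXY', map_setZero_map_mk]
    · have hmid : (Y.map ζ * X' * (Y' * X.map ζ)).map π = ((Y * X).map ζ).map π := by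
        have : Y.map ζ * X' * (Y' * X.map ζ) = Y.map ζ * (X' * Y') * X.map ζ := by
          simp only [Matrix.mul_assoc]
        rw [this, hXY', Matrix.map_mul, Matrix.map_mul, ← hXYζ, ← Matrix.map_mul,
          ← Matrix.map_mul, ← Matrix.mul_assoc, Matrix.mul_assoc, ← Matrix.map_mul,
          Matrix.map_mul, map_setZero_map_mk_congr k hYX, ← Matrix.map_mul,
          Matrix.map_one _ (map_zero _) (map_one _), Matrix.one_mul]
      rw [Matrix.map_mul, hX₂t, hY₂t, ← Matrix.map_mul]
      have : X₁ * Y₁ = X * (Y.map ζ * X' * (Y' * X.map ζ)) * Y := by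
        simp only [hX₁, hY₁, Matrix.mul_assoc]
      rw [this, Matrix.map_mul, Matrix.map_mul, hmid, map_setZero_map_mk_congr k hYX,
        Matrix.map_one _ (map_zero _) (map_one _), ← Matrix.map_mul, Matrix.mul_one,
        ← Matrix.map_mul, hXY]
    · rw [Matrix.map_mul, hX₂k, hY₂k, ← Matrix.map_mul, hYX']
    · rw [Matrix.map_mul, hX₂t, hY₂t, ← Matrix.map_mul]
      have : Y₁ * X₁ = Y' * X.map ζ * (Y * X) * (Y.map ζ * X') := by
        simp only [hX₁, hY₁, Matrix.mul_assoc]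
      rw [this, Matrix.map_mul, Matrix.map_mul (M := Y * X), hYX, ← Matrix.map_mul, Matrix.mul_one,
        ← Matrix.map_mul]
      have : Y' * X.map ζ * (Y.map ζ * X') = Y' * (X.map ζ * Y.map ζ) * X' := by
        simp only [Matrix.mul_assoc]
      rw [this, Matrix.map_mul, Matrix.map_mul, hXYζ, ← Matrix.map_mul, ← Matrix.map_mul, ← hXY',
        ← Matrix.mul_assoc, hYX', Matrix.one_mul, hYX']

end Boundary

/-! ### Splittings of homogeneous idempotent matrices close to a coordinate projection -/

section Blocks

variable {R : Type*} [CommRing R] {σ P : Type*} [Fintype σ] [AddCommGroup P] {lam : σ → P}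
  {s : Finset σ}

lemma Matrix.GradedSplits.of_submatrix_equiv {ι ι' : Type*} [Fintype ι] [Fintype ι'] {p : ι → P}
    {E : Matrix ι ι (AddMonoidAlgebra R (σ → ℕ))} (e : ι' ≃ ι)
    (h : (E.submatrix e e).GradedSplits lam s (p ∘ e)) : E.GradedSplits lam s p := by
  obtain ⟨κ, _, _, q, X, Y, hX, hY, hXY, hYX⟩ := h
  refine ⟨κ, inferInstance, inferInstance, q, X.submatrix e.symm id, Y.submatrix id e.symm,
    fun i j => ?_, fun i j => ?_, ?_, ?_⟩
  · simpa using hX (e.symm i) j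
  · simpa using hY i (e.symm j)
  · rw [← Matrix.submatrix_mul X Y e.symm id e.symm Function.bijective_id, hXY]
    simp
  · rw [Matrix.submatrix_mul_equiv Y X id e.symm id, hYX, Matrix.submatrix_id_id]

lemma Matrix.GradedSplits.blockDiagonal {K : Type} [Fintype K] [DecidableEq K] {ι : K → Type*}
    [∀ k, Fintype (ι k)] {p : (Σ k, ι k) → P}
    {E : ∀ k, Matrix (ι k) (ι k) (AddMonoidAlgebra R (σ → ℕ))}
    (h : ∀ k, (E k).GradedSplits lam s fun i => p ⟨k, i⟩) :
    (Matrix.blockDiagonal' E).GradedSplits lam s p := by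
  choose κ hκ hκ' q X Y hX hY hXY hYX using h
  refine ⟨Σ k, κ k, inferInstance, inferInstance, fun x => q x.1 x.2, Matrix.blockDiagonal' X,
    Matrix.blockDiagonal' Y, ?_, ?_, ?_, ?_⟩
  · rintro ⟨k, i⟩ ⟨l, j⟩
    by_cases h : k = l
    · subst h
      simpa using hX k i j
    · rw [Matrix.blockDiagonal'_apply_ne _ _ _ h]
      exact Submodule.zero_mem _
  · rintro ⟨k, i⟩ ⟨l, j⟩
    by_cases h : k = l
    · subst h
      simpa using hY k i j
    · rw [Matrix.blockDiagonal'_apply_ne _ _ _ h]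
      exact Submodule.zero_mem _
  · rw [← Matrix.blockDiagonal'_mul]
    simp only [hXY]
  · rw [← Matrix.blockDiagonal'_mul]
    simp only [hYX]
    exact Matrix.blockDiagonal'_one

/-- A block diagonal homogeneous matrix splits if its blocks do. -/
lemma Matrix.GradedSplits.of_blocks {K : Type} [Fintype K] [DecidableEq K] {ι : Type*} [Fintype ι]
    [DecidableEq ι] {p : ι → P} {E : Matrix ι ι (AddMonoidAlgebra R (σ → ℕ))} (col : ι → K)
    (hE : ∀ i j, col i ≠ col j → E i j = 0)
    (h : ∀ k, (E.submatrix Subtype.val Subtype.val).GradedSplits lam s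
      fun i : {i // col i = k} => p i) :
    E.GradedSplits lam s p := by
  refine .of_submatrix_equiv (Equiv.sigmaFiberEquiv col) ?_
  convert Matrix.GradedSplits.blockDiagonal (p := p ∘ Equiv.sigmaFiberEquiv col) h using 1
  refine Matrix.ext ?_
  rintro ⟨k, i⟩ ⟨l, j⟩
  by_cases hkl : k = l
  · subst hkl
    simp [Equiv.sigmaFiberEquiv]
  · rw [Matrix.blockDiagonal'_apply_ne _ _ _ hkl, Matrix.submatrix_apply]
    exact hE _ _ fun h => hkl (i.2.symm.trans (h.trans j.2))

end Blocks

section InvariantMonoid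

variable {σ P : Type*} [Fintype σ] [AddCommGroup P] (lam : σ → P)

/-- The monoid of Laurent monomials of degree zero in the variables indexed by `s` which are
either trivial or divisible by all these variables. -/
def interiorInvariants (s : Finset σ) : AddSubmonoid (σ → ℤ) where
  carrier := {c | c = 0 ∨ ∑ k, c k • lam k = 0 ∧ (∀ k ∉ s, c k = 0) ∧ ∀ k ∈ s, 1 ≤ c k}
  zero_mem' := Or.inl rfl
  add_mem' := by
    rintro a b (rfl | ⟨ha, ha', ha''⟩) (rfl | ⟨hb, hb', hb''⟩)
    · simp
    · simpa using Or.inr ⟨hb, hb', hb''⟩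
    · simpa using Or.inr ⟨ha, ha', ha''⟩
    · refine Or.inr ⟨?_, fun k hk => ?_, fun k hk => ?_⟩
      · simp [add_smul, Finset.sum_add_distrib, ha, hb]
      · simp [ha' k hk, hb' k hk]
      · have := ha'' k hk
        have := hb'' k hk
        rw [Pi.add_apply]
        omega

variable {lam} {s : Finset σ}

lemma interiorInvariants_spec {c : σ → ℤ} (hc : c ∈ interiorInvariants lam s) :
    ∑ k, c k • lam k = 0 ∧ (∀ k ∉ s, c k = 0) ∧ ∀ k, 0 ≤ c k := by
  classical
  rcases hc with rfl | ⟨h1, h2, h3⟩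
  · simp
  · refine ⟨h1, h2, fun k => ?_⟩
    by_cases hk : k ∈ s
    · have := h3 k hk
      omega
    · exact (h2 k hk).ge

lemma isCancellative_interiorInvariants :
    IsCancellativeAddMonoid (interiorInvariants lam s) :=
  fun _ _ _ h => Subtype.ext (add_left_cancel (congrArg Subtype.val h))

lemma isTorsionFree_interiorInvariants :
    IsTorsionFreeAddMonoid (interiorInvariants lam s) := fun n hn x y h => by
  refine Subtype.ext (funext fun k => ?_)
  have := congrFun (congrArg Subtype.val h) k
  simpa [hn.ne'] using this

lemma hasNoNontrivialAddUnits_interiorInvariants :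
    HasNoNontrivialAddUnits (interiorInvariants lam s) := fun x y h => by
  refine Subtype.ext (funext fun k => ?_)
  have h0 : x.1 k + y.1 k = 0 := congrFun (congrArg Subtype.val h) k
  have := (interiorInvariants_spec x.2).2.2 k
  have := (interiorInvariants_spec y.2).2.2 k
  change x.1 k = 0
  omega

lemma isSeminormal_interiorInvariants :
    IsSeminormalAddMonoid (interiorInvariants lam s) := by
  rintro a b ⟨y, hy⟩ -
  have hy' : ∀ k, a.1 k + a.1 k = b.1 k + b.1 k + y.1 k := congrFun (congrArg Subtype.val hy)
  have ha := (interiorInvariants_spec a.2)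
  have hb := (interiorInvariants_spec b.2)
  refine ⟨⟨a.1 - b.1, ?_⟩, Subtype.ext (add_sub_cancel _ _).symm⟩
  rcases y.2 with h | ⟨-, -, h⟩
  · refine Or.inl (funext fun k => ?_)
    have h1 := hy' k
    rw [h, Pi.zero_apply] at h1
    rw [Pi.sub_apply, Pi.zero_apply]
    omega
  · refine Or.inr ⟨?_, fun k hk => ?_, fun k hk => ?_⟩
    · simp [sub_smul, ha.1, hb.1]
    · simp [ha.2.1 k hk, hb.2.1 k hk]
    · have := hy' k
      have := h k hk
      rw [Pi.sub_apply]
      omega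

end InvariantMonoid

section Coset

variable {R : Type u} [CommRing R] {σ : Type} {P : Type*} [AddCommGroup P] {lam : σ → P}
  {s : Finset σ}

/-- The coefficient of `1` in a monoid algebra `R[Q]`, as a ring homomorphism when `Q` has no
nontrivial unit. -/
def constCoeffHom (R : Type*) [CommRing R] {Q : Type*} [AddCommMonoid Q]
    (hQ : HasNoNontrivialAddUnits Q) : AddMonoidAlgebra R Q →+* R where
  toFun f := f.coeff 0
  map_zero' := rfl
  map_one' := by simp [AddMonoidAlgebra.one_def]
  map_add' _ _ := rfl
  map_mul' f g := by
    rw [AddMonoidAlgebra.coeff_mul_antidiag f g 0 {(0, 0)}]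
    · simp
    · rintro ⟨a, b⟩
      rw [Finset.mem_singleton, Prod.mk.injEq]
      refine ⟨fun h => by simp [h.1, h.2], fun h => ⟨hQ a b h, hQ b a (by rwa [add_comm])⟩⟩

lemma single_mul_mul_single_mem {Q : Type*} [AddCommMonoid Q] {S T : Set Q} {x y : Q}
    (h : ∀ c ∈ S, x + c + y ∈ T) {f : AddMonoidAlgebra R Q} (hf : f ∈ suppIn R S) :
    AddMonoidAlgebra.single x 1 * f * AddMonoidAlgebra.single y 1 ∈ suppIn R T :=
  mul_mem_suppIn (S := {c | c + y ∈ T}) (T := {y}) (fun _ ha b hb => (hb : b = y) ▸ ha)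
    (mul_mem_suppIn (S := {x}) (fun a ha b hb => (ha : a = x) ▸ h b hb)
      (single_mem_suppIn (Set.mem_singleton _) 1) hf) (single_mem_suppIn (Set.mem_singleton _) 1)

/-- The inclusion of exponents of polynomials into exponents of Laurent polynomials. -/
def natToInt (σ : Type*) : (σ → ℕ) →+ (σ → ℤ) := (Nat.castAddMonoidHom ℤ).compLeft σ

lemma natToInt_injective : Function.Injective (natToInt σ) := fun _ _ h =>
  funext fun k => Nat.cast_injective (congrFun h k)

/-- The diagonal matrix of Laurent monomials with the given exponents. -/
noncomputable def monomialDiagonal (R : Type*) [CommRing R] {κ : Type*} [DecidableEq κ]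
    (b : κ → σ → ℤ) : Matrix κ κ (AddMonoidAlgebra R (σ → ℤ)) :=
  Matrix.diagonal fun i => AddMonoidAlgebra.single (b i) 1

lemma monomialDiagonal_mul_neg {κ : Type*} [Fintype κ] [DecidableEq κ] (b : κ → σ → ℤ) :
    monomialDiagonal R b * monomialDiagonal R (-b) = 1 := by
  rw [monomialDiagonal, monomialDiagonal, Matrix.diagonal_mul_diagonal, ← Matrix.diagonal_one]
  congr 1
  ext1 i
  simp [AddMonoidAlgebra.single_mul_single, AddMonoidAlgebra.one_def]

lemma monomialDiagonal_neg_mul {κ : Type*} [Fintype κ] [DecidableEq κ] (b : κ → σ → ℤ) :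
    monomialDiagonal R (-b) * monomialDiagonal R b = 1 := by
  simpa using monomialDiagonal_mul_neg (R := R) (-b)

variable [Fintype σ]

lemma exists_laurent_eq {d : P} {f : AddMonoidAlgebra R (σ → ℤ)}
    (hf : f ∈ suppIn R {c | ∑ k, c k • lam k = d ∧ (∀ k ∉ s, c k = 0) ∧ ∀ k, 0 ≤ c k}) :
    ∃ g ∈ suppIn R (exponents lam s d),
      AddMonoidAlgebra.mapDomainRingHom R (natToInt σ) g = f := by
  obtain ⟨g, rfl⟩ := exists_mapDomain_eq (natToInt σ) natToInt_injective f fun c hc =>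
    ⟨fun k => (c k).toNat, funext fun k => Int.toNat_of_nonneg ((hf c hc).2.2 k)⟩
  rw [mapDomain_mem_suppIn_iff _ natToInt_injective] at hf
  refine ⟨g, fun c hc => ⟨?_, fun k hk => ?_⟩, rfl⟩
  · simpa [natToInt] using (hf c hc).1
  · simpa [natToInt] using (hf c hc).2.1 k hk

lemma exists_laurent_matrix_eq {ι κ : Type*} {p : ι → P} {q : κ → P}
    {X : Matrix ι κ (AddMonoidAlgebra R (σ → ℤ))}
    (hX : ∀ i j, X i j ∈ suppIn R
      {c | ∑ k, c k • lam k = q j - p i ∧ (∀ k ∉ s, c k = 0) ∧ ∀ k, 0 ≤ c k}) :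
    ∃ Y : Matrix ι κ (AddMonoidAlgebra R (σ → ℕ)), Y.IsHomog lam s p q ∧
      Y.map (AddMonoidAlgebra.mapDomainRingHom R (natToInt σ)) = X := by
  choose Y hY hYX using fun i j => exists_laurent_eq (hX i j)
  exact ⟨Matrix.of Y, hY, Matrix.ext hYX⟩

/-- The ideal of the ring of invariants generated by the monomials divisible by the `e`-th powers
of the variables indexed by `s`. -/
def deepIdeal (R : Type*) [CommRing R] (lam : σ → P) (s : Finset σ) (e : ℕ) :
    Ideal (AddMonoidAlgebra R (interiorInvariants lam s)) :=
  suppIdeal R {c | ∀ k ∈ s, (e : ℤ) ≤ c.1 k} fun a _ hb k hk =>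
    (hb k hk).trans (le_add_of_nonneg_left ((interiorInvariants_spec a.2).2.2 k))

lemma ker_constCoeffHom_pow_le (e : ℕ) :
    RingHom.ker (constCoeffHom R (hasNoNontrivialAddUnits_interiorInvariants
      (lam := lam) (s := s))) ^ e ≤ deepIdeal R lam s e := by
  induction e with
  | zero =>
    intro f _ c _ k _
    simpa using (interiorInvariants_spec c.2).2.2 k
  | succ e ih =>
    rw [pow_succ, Ideal.mul_le]
    intro f hf g hg
    refine mul_mem_suppIn (T := {c | c ≠ 0}) (fun a ha b hb k hk => ?_) (ih hf)
      fun c hc h => hc (h ▸ hg)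
    have h1 := ha k hk
    have h2 := (b.2.resolve_left fun h => hb (Subtype.ext h)).2.2 k hk
    change ((e + 1 : ℕ) : ℤ) ≤ a.1 k + b.1 k
    push_cast
    omega

lemma deepIdeal_le_ker_constCoeffHom (hs : s.Nonempty) (e : ℕ) :
    deepIdeal R lam s (e + 1) ≤ RingHom.ker (constCoeffHom R
      (hasNoNontrivialAddUnits_interiorInvariants (lam := lam) (s := s))) := by
  intro f hf
  by_contra h
  obtain ⟨k, hk⟩ := hs
  have : ((e + 1 : ℕ) : ℤ) ≤ 0 := hf 0 h k hk
  omega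

lemma Matrix.IsHomog.diagonal {ι : Type*} [DecidableEq ι] {p : ι → P} (ε : ι → Prop) [DecidablePred ε] :
    (Matrix.diagonal fun i => if ε i then (1 : AddMonoidAlgebra R (σ → ℕ)) else 0).IsHomog
      lam s p p := fun i j => by
  rw [Matrix.diagonal_apply]
  split_ifs with h
  · subst h
    rw [sub_self, AddMonoidAlgebra.one_def]
    exact single_mem_suppIn zero_mem_exponents 1
  · exact Submodule.zero_mem _
  · exact Submodule.zero_mem _

variable {ι : Type} [Fintype ι] [DecidableEq ι] {p : ι → P} {p₀ : P} {b : ι → σ → ℤ} {N : ℕ}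

/-- Conjugating by monomials moves a homogeneous matrix that is close to a coordinate projection
into the ring of invariants. -/
lemma exists_invariant_conjugate (hb : ∀ i, p i = p₀ + ∑ k, b i k • lam k)
    (hbs : ∀ i, ∀ k ∉ s, b i k = 0) (hbN : ∀ i j k, b i k - b j k ≤ N)
    {E : Matrix ι ι (AddMonoidAlgebra R (σ → ℕ))} (hEh : E.IsHomog lam s p p)
    (ε : ι → Prop) [DecidablePred ε]
    (hEε : E.map (Ideal.Quotient.mk (vanishingIdeal R s (2 * N + 1))) =
      (Matrix.diagonal fun i => if ε i then (1 : AddMonoidAlgebra R (σ → ℕ)) else 0).map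
        (Ideal.Quotient.mk (vanishingIdeal R s (2 * N + 1)))) :
    ∃ G : Matrix ι ι (AddMonoidAlgebra R (interiorInvariants lam s)),
      G.map (AddMonoidAlgebra.mapDomainRingHom R (interiorInvariants lam s).subtype) =
        monomialDiagonal R b * E.map (AddMonoidAlgebra.mapDomainRingHom R (natToInt σ)) *
          monomialDiagonal R (-b) ∧
      ∀ i j, G i j - Matrix.diagonal (fun i => if ε i then 1 else 0) i j ∈
        deepIdeal R lam s (N + 1) := by
  set φ := AddMonoidAlgebra.mapDomainRingHom R (natToInt σ) with hφ
  set Δ : Matrix ι ι (AddMonoidAlgebra R (σ → ℕ)) :=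
    Matrix.diagonal fun i => if ε i then 1 else 0 with hΔ
  have hsupp : ∀ i j, (monomialDiagonal R b * (E - Δ).map φ * monomialDiagonal R (-b)) i j ∈
      suppIn R {c | ∑ k, c k • lam k = 0 ∧ (∀ k ∉ s, c k = 0) ∧
        ∀ k ∈ s, ((N + 1 : ℕ) : ℤ) ≤ c k} := by
    intro i j
    rw [monomialDiagonal, monomialDiagonal, Matrix.mul_diagonal, Matrix.diagonal_mul]
    refine single_mul_mul_single_mem (S := {c | ∑ k, c k • lam k = p j - p i ∧
      (∀ k ∉ s, c k = 0) ∧ ∀ k ∈ s, ((2 * N + 1 : ℕ) : ℤ) ≤ c k}) ?_ ?_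
    · rintro c ⟨h1, h2, h3⟩
      refine ⟨?_, fun k hk => ?_, fun k hk => ?_⟩
      · simp only [Pi.add_apply, Pi.neg_apply, add_smul, neg_smul, Finset.sum_add_distrib,
          Finset.sum_neg_distrib, h1, hb]
        abel
      · simp [h2 k hk, hbs _ k hk]
      · have h4 := h3 k hk
        have h5 := hbN j i k
        simp only [Pi.add_apply, Pi.neg_apply]
        push_cast at h4 ⊢
        omega
    · rw [Matrix.map_apply, hφ, mapDomain_mem_suppIn_iff _ natToInt_injective]
      intro c hc
      have h1 := (hEh.sub (Matrix.IsHomog.diagonal ε)) i j c hc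
      have h2 := Matrix.map_mk_eq_iff.1 hEε i j c hc
      exact ⟨by simpa [natToInt] using h1.1, fun k hk => by simpa [natToInt] using h1.2 k hk,
        fun k hk => Nat.cast_le.2 (h2 k hk)⟩
  choose g hg using fun i j => exists_mapDomain_eq (interiorInvariants lam s).subtype
    Subtype.val_injective _ fun c hc => by
      obtain ⟨h1, h2, h3⟩ := hsupp i j c hc
      refine ⟨⟨c, Or.inr ⟨h1, h2, fun k hk => le_trans ?_ (h3 k hk)⟩⟩, rfl⟩
      omega
  refine ⟨Matrix.of g + Matrix.diagonal (fun i => if ε i then 1 else 0), ?_, fun i j => ?_⟩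
  · have h1 : (Matrix.of g).map
        (AddMonoidAlgebra.mapDomainRingHom R (interiorInvariants lam s).subtype) =
        monomialDiagonal R b * (E - Δ).map φ * monomialDiagonal R (-b) := Matrix.ext hg
    have h2 : monomialDiagonal R b * Δ.map φ * monomialDiagonal R (-b) = Δ.map φ := by
      have : monomialDiagonal R b * Δ.map φ = Δ.map φ * monomialDiagonal R b := by
        simp only [hΔ, monomialDiagonal, Matrix.diagonal_map (map_zero φ),
          Matrix.diagonal_mul_diagonal, mul_comm]
      rw [this, Matrix.mul_assoc, monomialDiagonal_mul_neg, Matrix.mul_one]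
    have h3 : (Matrix.diagonal fun i => if ε i then
        (1 : AddMonoidAlgebra R (interiorInvariants lam s)) else 0).map
        (AddMonoidAlgebra.mapDomainRingHom R (interiorInvariants lam s).subtype) = Δ.map φ := by
      rw [Matrix.diagonal_map (map_zero _), hΔ, Matrix.diagonal_map (map_zero _)]
      congr 1
      ext1 i
      by_cases hi : ε i <;> simp [hi, -AddMonoidAlgebra.mapDomainRingHom_apply]
    rw [Matrix.map_add _ (map_add _), h1, h3, Matrix.map_sub _ (map_sub φ), Matrix.mul_sub,
      Matrix.sub_mul, h2, sub_add_cancel]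
  · rw [Matrix.add_apply, add_sub_cancel_right, Matrix.of_apply]
    have := hsupp i j
    rw [← hg, mapDomain_mem_suppIn_iff _ Subtype.val_injective] at this
    exact fun c hc => (this c hc).2.2

lemma gradedSplits_of_near_diagonal (hR : CondDaggerDagger R) (hs : s.Nonempty)
    (hb : ∀ i, p i = p₀ + ∑ k, b i k • lam k) (hbs : ∀ i, ∀ k ∉ s, b i k = 0)
    (hbN : ∀ i j k, b i k - b j k ≤ N)
    {E : Matrix ι ι (AddMonoidAlgebra R (σ → ℕ))} (hE : E * E = E) (hEh : E.IsHomog lam s p p)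
    (ε : ι → Prop) [DecidablePred ε]
    (hEε : E.map (Ideal.Quotient.mk (vanishingIdeal R s (2 * N + 1))) =
      (Matrix.diagonal fun i => if ε i then (1 : AddMonoidAlgebra R (σ → ℕ)) else 0).map
        (Ideal.Quotient.mk (vanishingIdeal R s (2 * N + 1)))) :
    E.GradedSplits lam s p := by
  obtain ⟨G, hG, hGε⟩ := exists_invariant_conjugate hb hbs hbN hEh ε hEε
  set φ := AddMonoidAlgebra.mapDomainRingHom R (natToInt σ) with hφ
  have hφi : Function.Injective φ := AddMonoidAlgebra.mapDomain_injective natToInt_injective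
  set ψ := AddMonoidAlgebra.mapDomainRingHom R (interiorInvariants lam s).subtype with hψ
  have hψi : Function.Injective ψ :=
    AddMonoidAlgebra.mapDomain_injective Subtype.val_injective
  have hGG : G * G = G := by
    refine Matrix.map_injective hψi ?_
    change (G * G).map ψ = G.map ψ
    rw [Matrix.map_mul, hG]
    calc _ = monomialDiagonal R b * E.map φ *
          (monomialDiagonal R (-b) * monomialDiagonal R b) * E.map φ *
            monomialDiagonal R (-b) := by simp only [Matrix.mul_assoc]
      _ = _ := by
        rw [monomialDiagonal_neg_mul, Matrix.mul_one, Matrix.mul_assoc (monomialDiagonal R b),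
          ← Matrix.map_mul, hE]
  obtain ⟨U, V, hUV, hVU, hU, hV⟩ := exists_splitting_diagonal_mod
    (constCoeffHom R hasNoNontrivialAddUnits_interiorInvariants)
    AddMonoidAlgebra.singleZeroRingHom
    (fun x => show (AddMonoidAlgebra.single 0 x).coeff 0 = x by simp)
    (hR.idempotentMatricesSplit _ isCancellative_interiorInvariants
      isTorsionFree_interiorInvariants isSeminormal_interiorInvariants
      hasNoNontrivialAddUnits_interiorInvariants)
    (deepIdeal R lam s (N + 1)) (N + 1) (ker_constCoeffHom_pow_le _)
    (deepIdeal_le_ker_constCoeffHom hs N) G hGG ε hGε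
  have hback : ∀ (i j : ι) (f : AddMonoidAlgebra R (interiorInvariants lam s)),
      (i ≠ j → f ∈ deepIdeal R lam s (N + 1)) →
      AddMonoidAlgebra.single ((-b) i) 1 * ψ f * AddMonoidAlgebra.single (b j) 1 ∈
        suppIn R {c | ∑ k, c k • lam k = p j - p i ∧ (∀ k ∉ s, c k = 0) ∧ ∀ k, 0 ≤ c k} := by
    intro i j f hf
    refine single_mul_mul_single_mem (S := {c | (∑ k, c k • lam k = 0 ∧ (∀ k ∉ s, c k = 0) ∧
      ∀ k, 0 ≤ c k) ∧ (i ≠ j → ∀ k ∈ s, ((N + 1 : ℕ) : ℤ) ≤ c k)}) ?_ ?_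
    · rintro c ⟨⟨h1, h2, h3⟩, h4⟩
      refine ⟨?_, fun k hk => ?_, fun k => ?_⟩
      · simp only [Pi.add_apply, Pi.neg_apply, add_smul, neg_smul, Finset.sum_add_distrib,
          Finset.sum_neg_distrib, h1, hb]
        abel
      · simp [h2 k hk, hbs _ k hk]
      · simp only [Pi.add_apply, Pi.neg_apply]
        by_cases hij : i = j
        · subst hij
          simpa using h3 k
        · by_cases hk : k ∈ s
          · have h5 := h4 hij k hk
            have h6 := hbN i j k
            push_cast at h5
            omega
          · simp [h2 k hk, hbs _ k hk]
    · rw [hψ, mapDomain_mem_suppIn_iff _ Subtype.val_injective]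
      exact fun c hc => ⟨interiorInvariants_spec c.2, fun hij => hf hij c hc⟩
  obtain ⟨X, hX, hXφ⟩ := exists_laurent_matrix_eq (p := p) (q := fun j : {i // ε i} => p j)
    (X := monomialDiagonal R (-b) * U.map ψ * monomialDiagonal R fun j : {i // ε i} => b j) (lam := lam)
    (s := s) fun i j => by
      rw [monomialDiagonal, monomialDiagonal, Matrix.mul_diagonal, Matrix.diagonal_mul]
      exact hback i j.1 _ (hU i j)
  obtain ⟨Y, hY, hYφ⟩ := exists_laurent_matrix_eq (p := fun j : {i // ε i} => p j) (q := p)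
    (X := monomialDiagonal R (-fun j : {i // ε i} => b j) * V.map ψ * monomialDiagonal R b)
    (lam := lam) (s := s) fun i j => by
      rw [monomialDiagonal, monomialDiagonal, Matrix.mul_diagonal, Matrix.diagonal_mul]
      exact hback i.1 j _ (hV i j)
  refine ⟨{i // ε i}, inferInstance, inferInstance, fun j => p j, X, Y, hX, hY,
    Matrix.map_injective hφi ?_, Matrix.map_injective hφi ?_⟩
  · change (X * Y).map φ = E.map φ
    rw [Matrix.map_mul, hXφ, hYφ]
    calc _ = monomialDiagonal R (-b) * (U.map ψ * ((monomialDiagonal R fun j : {i // ε i} => b j) *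
          monomialDiagonal R (-fun j : {i // ε i} => b j)) * V.map ψ) *
            monomialDiagonal R b := by simp only [Matrix.mul_assoc]
      _ = (monomialDiagonal R (-b) * monomialDiagonal R b) * E.map φ *
          (monomialDiagonal R (-b) * monomialDiagonal R b) := by
        rw [monomialDiagonal_mul_neg, Matrix.mul_one, ← Matrix.map_mul, hUV, hG]
        simp only [Matrix.mul_assoc]
      _ = E.map φ := by rw [monomialDiagonal_neg_mul, Matrix.one_mul, Matrix.mul_one]
  · change (Y * X).map φ = (1 : Matrix _ _ _).map φ
    rw [Matrix.map_mul, hXφ, hYφ]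
    calc _ = monomialDiagonal R (-fun j : {i // ε i} => b j) * (V.map ψ *
          (monomialDiagonal R b * monomialDiagonal R (-b)) * U.map ψ) *
            monomialDiagonal R fun j : {i // ε i} => b j := by simp only [Matrix.mul_assoc]
      _ = 1 := by
        rw [monomialDiagonal_mul_neg, Matrix.mul_one, ← Matrix.map_mul, hVU,
          Matrix.map_one _ (map_zero _) (map_one _), Matrix.mul_one, monomialDiagonal_neg_mul]
      _ = _ := (Matrix.map_one _ (map_zero _) (map_one _)).symm

end Coset

/-! ### Splitting homogeneous idempotent matrices -/

section Splitting

variable {R : Type u} [CommRing R] {σ : Type} {s : Finset σ} {ι : Type} [Fintype ι]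
  [DecidableEq ι]

lemma pow_apply_mem_vanishingIdeal {K : Matrix ι ι (AddMonoidAlgebra R (σ → ℕ))}
    (hK : ∀ i j, K i j ∈ vanishingIdeal R s 1) (a : ℕ) :
    ∀ i j, (K ^ a) i j ∈ vanishingIdeal R s a := by
  induction a with
  | zero => exact fun i j c _ k _ => Nat.zero_le _
  | succ a ih =>
    intro i j
    rw [pow_succ, Matrix.mul_apply]
    refine Submodule.sum_mem _ fun l _ => mul_mem_suppIn ?_ (ih i l) (hK l j)
    exact fun c hc d hd k hk => Nat.add_le_add (hc k hk) (hd k hk)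

lemma map_mk_pow_eq_zero {K : Matrix ι ι (AddMonoidAlgebra R (σ → ℕ))}
    (hK : K.map (Ideal.Quotient.mk (vanishingIdeal R s 1)) = 0) {a m : ℕ} (ham : a ≤ m) :
    (K ^ m).map (Ideal.Quotient.mk (vanishingIdeal R s a)) = 0 := by
  refine Matrix.ext fun i j => Ideal.Quotient.eq_zero_iff_mem.2 fun c hc k hk => ham.trans ?_
  exact pow_apply_mem_vanishingIdeal
    (fun i j => Ideal.Quotient.eq_zero_iff_mem.1 (congrFun (congrFun hK i) j)) m i j c hc k hk

variable [Fintype σ] {P : Type*} [AddCommGroup P] {lam : σ → P} {p : ι → P}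

lemma CondDaggerDagger.idempotentMatricesSplit_base (hR : CondDaggerDagger R) :
    IdempotentMatricesSplit R :=
  .of_ringEquiv (AddMonoidAlgebra.uniqueRingEquiv PUnit.{1}).symm <|
    hR.idempotentMatricesSplit PUnit (fun _ _ _ _ => rfl) (fun _ _ _ _ _ => rfl)
      (fun _ _ _ _ => ⟨0, rfl⟩) fun _ _ _ => rfl

lemma gradedSplits_of_constant (hR : CondDaggerDagger R) {p₀ : P} (hp : ∀ i, p i = p₀)
    {E : Matrix ι ι (AddMonoidAlgebra R (σ → ℕ))} (hE : E * E = E) (hEh : E.IsHomog lam ∅ p p) :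
    E.GradedSplits lam ∅ p := by
  set C : R →+* AddMonoidAlgebra R (σ → ℕ) := AddMonoidAlgebra.singleZeroRingHom with hC
  have hC00 (x : R) : (C x).coeff 0 = x := by
    change (AddMonoidAlgebra.single 0 x).coeff 0 = x
    simp
  have hCi : Function.Injective C := fun x y h => by rw [← hC00 x, h, hC00]
  have hC0 (x : R) {d : P} (hd : d = 0) : C x ∈ suppIn R (exponents lam ∅ d) :=
    hd ▸ single_mem_suppIn zero_mem_exponents x
  have hEC : (E.map fun f => f.coeff 0).map C = E := by
    refine Matrix.ext fun i j => AddMonoidAlgebra.coeff_injective (Finsupp.ext fun c => ?_)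
    change (AddMonoidAlgebra.single 0 ((E i j).coeff 0)).coeff c = _
    rw [AddMonoidAlgebra.coeff_single, Finsupp.single_apply]
    split_ifs with h
    · rw [h]
    · by_contra h'
      exact h (funext fun k => ((hEh i j c (Ne.symm h')).2 k (Finset.notMem_empty k)).symm)
  obtain ⟨r, U, V, hUV, hVU⟩ := hR.idempotentMatricesSplit_base ι (E.map fun f => f.coeff 0) <|
    Matrix.map_injective hCi (by
      change (_ * _ : Matrix _ _ _).map C = (E.map _).map C
      rw [Matrix.map_mul, hEC, hE])
  refine ⟨Fin r, inferInstance, inferInstance, fun _ => p₀, U.map C, V.map C,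
    fun i j => hC0 _ (by simp [hp]), fun i j => hC0 _ (by simp [hp]), ?_, ?_⟩
  · rw [← Matrix.map_mul, hUV, hEC]
  · rw [← Matrix.map_mul, hVU, Matrix.map_one _ (map_zero C) (map_one C)]

/-- Degrees that differ by the degree of a Laurent monomial in the variables indexed by `s`. -/
def degreeSetoid (lam : σ → P) (s : Finset σ) (p : ι → P) : Setoid ι where
  r i j := ∃ c : σ → ℤ, p i = p j + ∑ k, c k • lam k ∧ ∀ k ∉ s, c k = 0
  iseqv := by
    refine ⟨fun i => ⟨0, by simp⟩, ?_, ?_⟩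
    · rintro i j ⟨c, h, hc⟩
      exact ⟨-c, by simp [h], fun k hk => by simp [hc k hk]⟩
    · rintro i j l ⟨c, h, hc⟩ ⟨d, h', hd⟩
      refine ⟨c + d, ?_, fun k hk => by simp [hc k hk, hd k hk]⟩
      simp only [h, h', Pi.add_apply, add_smul, Finset.sum_add_distrib]
      abel

/-- A homogeneous idempotent matrix that is sufficiently close to a coordinate projection, in
terms of the degrees only, splits. -/
lemma exists_forall_gradedSplits_of_near_diagonal (hR : CondDaggerDagger R) (lam : σ → P)
    (s : Finset σ) (p : ι → P) :
    ∃ N : ℕ, ∀ E : Matrix ι ι (AddMonoidAlgebra R (σ → ℕ)), E * E = E → E.IsHomog lam s p p →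
      ∀ (ε : ι → Prop) [DecidablePred ε],
      E.map (Ideal.Quotient.mk (vanishingIdeal R s (N + 1))) =
        (Matrix.diagonal fun i => if ε i then (1 : AddMonoidAlgebra R (σ → ℕ)) else 0).map
          (Ideal.Quotient.mk (vanishingIdeal R s (N + 1))) → E.GradedSplits lam s p := by
  classical
  let S := degreeSetoid lam s p
  have hout (i : ι) : S.r i (Quotient.out (Quotient.mk S i)) :=
    S.symm (Quotient.mk_out i)
  choose b hb hbs using hout
  obtain ⟨N, hN⟩ := Set.Finite.bddAbove (Set.finite_range fun x : ι × ι × σ =>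
    (b x.1 x.2.2 - b x.2.1 x.2.2).toNat)
  refine ⟨2 * N, fun E hE hEh ε _ hEε => ?_⟩
  have hE0 : ∀ i j, Quotient.mk S i ≠ Quotient.mk S j → E i j = 0 := by
    intro i j hij
    by_contra h
    obtain ⟨c, hc⟩ : ∃ c, (E i j).coeff c ≠ 0 := by
      by_contra! h'
      exact h (AddMonoidAlgebra.coeff_injective (Finsupp.ext h'))
    obtain ⟨h1, h2⟩ := hEh i j c hc
    refine hij (Quotient.sound (S.symm ⟨fun k => c k, ?_, fun k hk => by simp [h2 k hk]⟩))
    simp [h1]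
  refine .of_blocks (Quotient.mk S) hE0 fun k => ?_
  set F : Matrix {i // Quotient.mk S i = k} {i // Quotient.mk S i = k} _ :=
    E.submatrix Subtype.val Subtype.val with hF
  have hEk : F * F = F := by
    refine Matrix.ext fun i j => ?_
    rw [hF, Matrix.submatrix_apply, ← congrFun (congrFun hE i.1) j.1, Matrix.mul_apply,
      Matrix.mul_apply, ← Fintype.sum_subtype_add_sum_subtype (fun l => Quotient.mk S l = k)]
    simp only [Matrix.submatrix_apply]
    rw [left_eq_add]
    exact Finset.sum_eq_zero fun l _ => by
      rw [hE0 i.1 l.1 fun h => l.2 (h ▸ i.2), zero_mul]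
  rcases s.eq_empty_or_nonempty with rfl | hs
  · refine gradedSplits_of_constant hR (p₀ := p k.out) (fun i => ?_) hEk fun i j => hEh i j
    rw [hb i, i.2, add_eq_left]
    exact Finset.sum_eq_zero fun l _ => by rw [hbs i l (Finset.notMem_empty l), zero_smul]
  · refine gradedSplits_of_near_diagonal hR hs (ι := {i // Quotient.mk S i = k}) (p₀ := p k.out)
      (b := fun i => b i) (N := N) (fun i => by rw [hb i.1, i.2]) (fun i => hbs i) (fun i j l => ?_) hEk (fun i j => hEh i j)
      (fun i => ε i) ?_
    · exact (Int.self_le_toNat _).trans (Nat.cast_le.2 (hN ⟨(i.1, j.1, l), rfl⟩))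
    · rw [Matrix.map_mk_eq_iff] at hEε ⊢
      intro i j
      have := hEε i j
      simp only [Matrix.diagonal_apply, Subtype.ext_iff] at this ⊢
      exact this

/-- A splitting along the coordinate hyperplanes replaces a homogeneous idempotent matrix by an
equivalent one which is arbitrarily close to a coordinate projection. -/
lemma exists_near_diagonal {κ : Type} [Fintype κ] [DecidableEq κ] {q : κ → P}
    {E : Matrix ι ι (AddMonoidAlgebra R (σ → ℕ))} (hE : E * E = E) (hEh : E.IsHomog lam s p p)
    {X : Matrix ι κ (AddMonoidAlgebra R (σ → ℕ))} {Y : Matrix κ ι (AddMonoidAlgebra R (σ → ℕ))}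
    (hX : X.IsHomog lam s p q) (hY : Y.IsHomog lam s q p)
    (hXY : (X * Y).map (Ideal.Quotient.mk (vanishingIdeal R s 1)) =
      E.map (Ideal.Quotient.mk (vanishingIdeal R s 1)))
    (hYX : (Y * X).map (Ideal.Quotient.mk (vanishingIdeal R s 1)) =
      (1 : Matrix κ κ _).map (Ideal.Quotient.mk (vanishingIdeal R s 1))) (a : ℕ) :
    ∃ (G : Matrix ι (κ ⊕ ι) (AddMonoidAlgebra R (σ → ℕ)))
      (H : Matrix (κ ⊕ ι) ι (AddMonoidAlgebra R (σ → ℕ))),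
      G.IsHomog lam s p (Sum.elim q p) ∧ H.IsHomog lam s (Sum.elim q p) p ∧ E * G = G ∧ G * H = E ∧
      (H * G).map (Ideal.Quotient.mk (vanishingIdeal R s (a + 1))) =
        (Matrix.diagonal fun x : κ ⊕ ι => if x.isLeft then 1 else 0).map
          (Ideal.Quotient.mk (vanishingIdeal R s (a + 1))) := by
  set π := Ideal.Quotient.mk (vanishingIdeal R s 1) with hπ
  set ρ := Ideal.Quotient.mk (vanishingIdeal R s (a + 1)) with hρ
  set U := E * X with hU
  set V := Y * E with hV
  have hUh : U.IsHomog lam s p q := hEh.mul hX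
  have hVh : V.IsHomog lam s q p := hY.mul hEh
  have hEU : E * U = U := by rw [hU, ← Matrix.mul_assoc, hE]
  set K := E - U * V with hK
  set Z := 1 - V * U with hZ
  have hKh : K.IsHomog lam s p p := hEh.sub (hUh.mul hVh)
  have hKπ : K.map π = 0 := by
    have : U * V = E * (X * Y) * E := by simp only [hU, hV, Matrix.mul_assoc]
    rw [hK, Matrix.map_sub _ (map_sub π), this, Matrix.map_mul, Matrix.map_mul, hXY,
      ← Matrix.map_mul, ← Matrix.map_mul, hE, hE, sub_self]
  have hZπ : Z.map π = 0 := by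
    have : V * U = Y * (E * E) * X := by simp only [hU, hV, Matrix.mul_assoc]
    rw [hZ, Matrix.map_sub _ (map_sub π), this, hE, Matrix.map_mul, Matrix.map_mul, ← hXY,
      ← Matrix.map_mul, ← Matrix.map_mul]
    have : Y * (X * Y) * X = Y * X * (Y * X) := by simp only [Matrix.mul_assoc]
    rw [this, Matrix.map_mul, hYX, ← Matrix.map_mul, Matrix.mul_one, sub_self]
  have hEK : E * K = K := by rw [hK, Matrix.mul_sub, hE, ← Matrix.mul_assoc, hEU]
  have hKU (i : ℕ) : K ^ i * U = U * Z ^ i := by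
    induction i with
    | zero => rw [pow_zero, pow_zero, Matrix.one_mul, Matrix.mul_one]
    | succ i ih =>
      have : K * U = U * Z := by
        rw [hK, hZ, Matrix.sub_mul, Matrix.mul_sub, hEU, Matrix.mul_one, Matrix.mul_assoc]
      rw [pow_succ, pow_succ', Matrix.mul_assoc, this, ← Matrix.mul_assoc, ih, Matrix.mul_assoc,
        ← pow_succ, pow_succ']
  set m := a + 1 + (a + 1) with hm
  set S := ∑ i ∈ Finset.range m, K ^ i with hS
  have hEKm : E * K ^ m = K ^ m := by
    rw [hm, ← add_assoc, pow_succ', ← Matrix.mul_assoc, hEK]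
  have hUVS : U * V * S = E - K ^ m := by
    have : U * V = E * (1 - K) := by
      rw [Matrix.mul_sub, Matrix.mul_one, hEK, hK, sub_sub_cancel]
    rw [this, Matrix.mul_assoc, hS, mul_neg_geom_sum, Matrix.mul_sub, Matrix.mul_one, hEKm]
  have hVSU : V * S * U = 1 - Z ^ m := by
    have : S * U = U * ∑ i ∈ Finset.range m, Z ^ i := by
      rw [hS, Matrix.sum_mul, Matrix.mul_sum]
      exact Finset.sum_congr rfl fun i _ => hKU i
    rw [Matrix.mul_assoc, this, ← Matrix.mul_assoc, ← mul_neg_geom_sum, hZ, sub_sub_cancel]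
  have hSh : S.IsHomog lam s p p := .sum _ fun i _ => hKh.pow i
  refine ⟨Matrix.fromCols U (K ^ (a + 1)), Matrix.fromRows (V * S) (K ^ (a + 1)), ?_, ?_, ?_, ?_,
    ?_⟩
  · rintro i (j | j)
    · exact hUh i j
    · exact hKh.pow (a + 1) i j
  · rintro (i | i) j
    · exact hVh.mul hSh i j
    · exact hKh.pow (a + 1) i j
  · rw [Matrix.mul_fromCols, hEU, pow_succ', ← Matrix.mul_assoc, hEK]
  · rw [Matrix.fromCols_mul_fromRows, ← Matrix.mul_assoc, hUVS, ← pow_add, sub_add_cancel]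
  · have hdiag : (Matrix.diagonal fun x : κ ⊕ ι =>
        if x.isLeft then (1 : AddMonoidAlgebra R (σ → ℕ)) else 0) = Matrix.fromBlocks 1 0 0 0 := by
      rw [← Matrix.diagonal_one, ← Matrix.diagonal_zero (n := ι), Matrix.fromBlocks_diagonal]
      congr 1
      ext1 (i | i) <;> rfl
    have hZ0 := map_mk_pow_eq_zero hZπ (a := a + 1) (m := m) (Nat.le_add_left _ _)
    have hK0 := map_mk_pow_eq_zero hKπ (le_refl (a + 1))
    rw [Matrix.fromRows_mul_fromCols, hVSU, hdiag, Matrix.fromBlocks_map, Matrix.fromBlocks_map,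
      Matrix.map_sub _ (map_sub ρ), hZ0, sub_zero, Matrix.map_mul, hK0, Matrix.mul_zero,
      Matrix.map_mul, hK0, Matrix.zero_mul, Matrix.map_mul, hK0, Matrix.zero_mul]
    simp only [Matrix.map_zero _ (map_zero ρ)]

/-- Homogeneous idempotent matrices over a polynomial ring are projections onto graded free
direct summands. -/
theorem gradedSplits_of_idempotent (hR : CondDaggerDagger R) (lam : σ → P) (s : Finset σ) :
    ∀ (ι : Type) [Fintype ι] [DecidableEq ι] (p : ι → P)
      (E : Matrix ι ι (AddMonoidAlgebra R (σ → ℕ))), E * E = E → E.IsHomog lam s p p →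
      E.GradedSplits lam s p := by
  classical
  induction s using Finset.strongInduction with
  | H s ih =>
    intro ι _ _ p E hE hEh
    obtain ⟨κ, _, _, q, X, Y, hX, hY, hXY, hYX⟩ := exists_splitting_mod_boundary
      (fun k hk => ih _ (Finset.erase_ssubset hk)) hE hEh s Finset.Subset.rfl
    obtain ⟨N, hN⟩ := exists_forall_gradedSplits_of_near_diagonal hR lam s (Sum.elim q p)
    obtain ⟨G, H, hG, hH, hEG, hGH, hHG⟩ := exists_near_diagonal hE hEh hX hY hXY hYX N
    have hid : H * G * (H * G) = H * G := by
      rw [Matrix.mul_assoc, ← Matrix.mul_assoc G, hGH, hEG]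
    obtain ⟨μ, _, _, r, U, V, hU, hV, hUV, hVU⟩ := hN (H * G) hid (hH.mul hG) _ hHG
    refine ⟨μ, inferInstance, inferInstance, r, G * U, V * H, hG.mul hU, hV.mul hH, ?_, ?_⟩
    · calc G * U * (V * H) = G * (U * V) * H := by simp only [Matrix.mul_assoc]
        _ = G * H * (G * H) := by simp only [hUV, Matrix.mul_assoc]
        _ = E := by rw [hGH, hE]
    · calc V * H * (G * U) = V * (H * G) * U := by simp only [Matrix.mul_assoc]
        _ = V * U * (V * U) := by simp only [← hUV, Matrix.mul_assoc]
        _ = 1 := by rw [hVU, Matrix.one_mul]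

end Splitting

/-! ### Graded projective modules -/

section GradedModule

variable {R : Type*} [CommRing R] {Q P : Type*} [AddCommMonoid Q] [AddCommGroup P]
  (deg : Q →+ P)

lemma monAlgGrading_eq_suppIn (d : P) : monAlgGrading R deg d = suppIn R {c | deg c = d} :=
  (suppIn_eq_span _).symm

variable [DecidableEq P]

/-- The homogeneous component of degree `d` of an element of `R[Q]`. -/
noncomputable def homogComponent (d : P) : AddMonoidAlgebra R Q →ₗ[R] AddMonoidAlgebra R Q where
  toFun f := .ofCoeff (f.coeff.filter fun c => deg c = d)
  map_add' f g := AddMonoidAlgebra.coeff_injective (by simp [Finsupp.filter_add])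
  map_smul' r f := AddMonoidAlgebra.coeff_injective (by simp [Finsupp.filter_smul])

lemma homogComponent_single (d : P) (c : Q) (r : R) :
    homogComponent deg d (AddMonoidAlgebra.single c r) =
      if deg c = d then AddMonoidAlgebra.single c r else 0 := by
  refine AddMonoidAlgebra.coeff_injective ?_
  simp only [homogComponent, LinearMap.coe_mk, AddHom.coe_mk, AddMonoidAlgebra.coeff_single]
  split_ifs with h
  · exact Finsupp.filter_single_of_pos _ h
  · exact Finsupp.filter_single_of_neg _ h

lemma homogComponent_mem (d : P) (f : AddMonoidAlgebra R Q) :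
    homogComponent deg d f ∈ suppIn R {c | deg c = d} := by
  intro c hc
  by_contra h
  exact hc (Finsupp.filter_apply_neg _ _ h)

lemma homogComponent_single_mul (d : P) (c : Q) (r : R) (f : AddMonoidAlgebra R Q) :
    homogComponent deg (deg c + d) (AddMonoidAlgebra.single c r * f) =
      AddMonoidAlgebra.single c r * homogComponent deg d f := by
  induction f using AddMonoidAlgebra.induction_linear with
  | zero => simp
  | add f g hf hg => rw [mul_add, map_add, map_add, hf, hg, mul_add]
  | single a x =>
    rw [AddMonoidAlgebra.single_mul_single, homogComponent_single, homogComponent_single, map_add]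
    simp only [add_right_inj]
    split_ifs
    · rw [AddMonoidAlgebra.single_mul_single]
    · rw [mul_zero]

variable {M : Type*} [AddCommGroup M] [Module R M] [Module (AddMonoidAlgebra R Q) M]
  [IsScalarTower R (AddMonoidAlgebra R Q) M] {ℳ : P → Submodule R M}

variable {deg} in
lemma IsGradedModule.single_smul_mem (hM : IsGradedModule (monAlgGrading R deg) ℳ) (a : Q) (r : R)
    {c : P} {m : M} (hm : m ∈ ℳ c) : AddMonoidAlgebra.single a r • m ∈ ℳ (deg a + c) := by
  refine hM.smul_mem ?_ hm
  rw [monAlgGrading_eq_suppIn]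
  exact single_mem_suppIn (S := {c | deg c = deg a}) rfl r

variable {deg} in
lemma decompose_smul_apply [DirectSum.Decomposition ℳ]
    (hM : IsGradedModule (monAlgGrading R deg) ℳ) (f : AddMonoidAlgebra R Q) {c : P} {m : M}
    (hm : m ∈ ℳ c) (d : P) :
    (DirectSum.decompose ℳ (f • m) d : M) = homogComponent deg (d - c) f • m := by
  induction f using AddMonoidAlgebra.induction_linear with
  | zero => simp
  | add f g hf hg => simp [add_smul, hf, hg]
  | single a x =>
    have h := hM.single_smul_mem a x hm
    rw [homogComponent_single]
    split_ifs with had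
    · rw [had, sub_add_cancel] at h
      exact DirectSum.decompose_of_mem_same ℳ h
    · rw [zero_smul]
      exact DirectSum.decompose_of_mem_ne ℳ h fun h' => had (eq_sub_of_add_eq h')

variable {deg} in
/-- A section of a surjection from a graded free module can be made degree-preserving. -/
lemma exists_graded_section (hM : IsGradedModule (monAlgGrading R deg) ℳ) {ι : Type*} [Fintype ι]
    {p : ι → P} {g : ι → M} (hg : ∀ i, g i ∈ ℳ (p i))
    (τ : M →ₗ[AddMonoidAlgebra R Q] (ι → AddMonoidAlgebra R Q))
    (hτ : ∀ m, ∑ i, τ m i • g i = m) :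
    ∃ τ' : M →ₗ[AddMonoidAlgebra R Q] (ι → AddMonoidAlgebra R Q),
      (∀ m, ∑ i, τ' m i • g i = m) ∧
      ∀ c, ∀ m ∈ ℳ c, ∀ i, τ' m i ∈ suppIn R {x | deg x = c - p i} := by
  let _ := hM.is_internal.chooseDecomposition
  let T : M →ₗ[R] (ι → AddMonoidAlgebra R Q) :=
    DirectSum.toModule R P _ (fun c => LinearMap.pi fun i => homogComponent deg (c - p i) ∘ₗ
      LinearMap.proj i ∘ₗ τ.restrictScalars R ∘ₗ (ℳ c).subtype) ∘ₗ
    (DirectSum.decomposeLinearEquiv ℳ).toLinearMap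
  have hT {c : P} {m : M} (hm : m ∈ ℳ c) (i : ι) : T m i = homogComponent deg (c - p i) (τ m i) := by
    lift m to ℳ c using hm
    simp [T]
  have hTs (f : AddMonoidAlgebra R Q) (m : M) : T (f • m) = f • T m := by
    induction m using DirectSum.Decomposition.inductionOn ℳ with
    | zero => simp
    | add m n hm hn => rw [smul_add, map_add, hm, hn, map_add, smul_add]
    | homogeneous m =>
      induction f using AddMonoidAlgebra.induction_linear with
      | zero => simp
      | add f g hf hg => rw [add_smul, map_add, hf, hg, add_smul]
      | single a x =>
        ext1 i
        rw [hT (hM.single_smul_mem a x m.2), Pi.smul_apply, hT m.2, map_smul, Pi.smul_apply,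
          smul_eq_mul, smul_eq_mul, add_sub_assoc, homogComponent_single_mul]
  refine ⟨{ T with map_smul' := hTs }, fun m => ?_, fun c m hm i => ?_⟩
  · change ∑ i, T m i • g i = m
    induction m using DirectSum.Decomposition.inductionOn ℳ with
    | zero => simp
    | add m n hm hn => simp only [map_add, Pi.add_apply, add_smul, Finset.sum_add_distrib, hm, hn]
    | @homogeneous c m =>
      calc ∑ i, T m i • g i = ∑ i, (DirectSum.decompose ℳ (τ m i • g i) c : M) :=
            Finset.sum_congr rfl fun i _ => by rw [hT m.2, decompose_smul_apply hM _ (hg i)]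
        _ = (DirectSum.decompose ℳ (∑ i, τ m i • g i) c : M) := by
          rw [DirectSum.decompose_sum, DFinsupp.finsetSum_apply, AddSubmonoidClass.coe_finsetSum]
        _ = m := by rw [hτ, DirectSum.decompose_of_mem_same ℳ m.2]
  · change T m i ∈ _
    rw [hT hm]
    exact homogComponent_mem deg _ _

end GradedModule

lemma exists_homogeneous_generators {R P M A : Type*} [CommRing R] [DecidableEq P]
    [AddCommGroup M] [Module R M] [Ring A] [Module A M] {ℳ : P → Submodule R M} (hℳ : DirectSum.IsInternal ℳ)
    (hfin : Module.Finite A M) :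
    ∃ (N : ℕ) (p : Fin N → P) (g : Fin N → M), (∀ i, g i ∈ ℳ (p i)) ∧
      Submodule.span A (Set.range g) = ⊤ := by
  classical
  let _ := hℳ.chooseDecomposition
  obtain ⟨S, hS⟩ := hfin.fg_top
  let T : Finset M := S.biUnion fun m =>
    (DirectSum.decompose ℳ m).support.image fun c => (DirectSum.decompose ℳ m c : M)
  have hT (i : Fin T.card) : ∃ c, (T.equivFin.symm i : M) ∈ ℳ c := by
    obtain ⟨m, _, hm⟩ := Finset.mem_biUnion.1 (T.equivFin.symm i).2
    obtain ⟨c, _, hc⟩ := Finset.mem_image.1 hm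
    exact ⟨c, hc ▸ (DirectSum.decompose ℳ m c).2⟩
  choose p hp using hT
  refine ⟨T.card, p, fun i => T.equivFin.symm i, hp, top_le_iff.1 ?_⟩
  have hrange : Set.range (fun i => (T.equivFin.symm i : M)) = T := by
    rw [show (fun i => (T.equivFin.symm i : M)) = Subtype.val ∘ T.equivFin.symm from rfl,
      T.equivFin.symm.surjective.range_comp, Subtype.range_coe]
  rw [hrange, ← hS, Submodule.span_le]
  intro m hm
  rw [← DirectSum.sum_support_decompose ℳ m]
  exact Submodule.sum_mem _ fun c hc => Submodule.subset_span <|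
    Finset.mem_biUnion.2 ⟨m, hm, Finset.mem_image_of_mem _ hc⟩

/-- The grading of a free module of finite rank by the degrees of its basis elements. -/
def coordGrading (R : Type*) [CommRing R] {κ P : Type*} (q : κ → P) (d : P) :
    Submodule R (κ → R) where
  carrier := {f | ∀ k, f k ≠ 0 → q k = d}
  zero_mem' k h := absurd rfl h
  add_mem' {f g} hf hg k h := by
    by_cases hk : f k = 0
    · exact hg k fun hk' => h (by simp [hk, hk'])
    · exact hf k hk
  smul_mem' r f hf k h := hf k fun hk => h (by simp [hk])

lemma single_mem_coordGrading {R κ P : Type*} [CommRing R] [DecidableEq κ] (q : κ → P) (k : κ) (r : R) :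
    Pi.single k r ∈ coordGrading R q (q k) := fun l hl => by
  by_contra h
  exact hl (Pi.single_eq_of_ne (M := fun _ => R) (fun h' => h (congrArg q h')) r)

lemma isInternal_coordGrading {R κ P : Type*} [CommRing R] [Fintype κ] [DecidableEq κ]
    [DecidableEq P] (q : κ → P) :
    DirectSum.IsInternal (coordGrading R q) := by
  let D : (κ → R) →ₗ[R] DirectSum P fun d => coordGrading R q d :=
    ∑ k, DirectSum.lof R P (fun d => coordGrading R q d) (q k) ∘ₗ
      (LinearMap.single R (fun _ => R) k).codRestrict (coordGrading R q (q k))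
        (single_mem_coordGrading q k) ∘ₗ LinearMap.proj k
  let _ : DirectSum.Decomposition (coordGrading R q) := .ofLinearMap _ D
    (LinearMap.ext fun f => by
      simp only [D, LinearMap.comp_apply, LinearMap.sum_apply, map_sum,
        DirectSum.coeLinearMap_lof]
      exact LinearMap.sum_single_apply (fun _ => R) f)
    (DirectSum.linearMap_ext _ fun d => LinearMap.ext fun f => by
      have hf (k : κ) : Pi.single k (f.1 k) ∈ coordGrading R q d := fun l hl => by
        obtain rfl : l = k := by_contra fun h => hl (Pi.single_eq_of_ne (M := fun _ => R) h _)
        exact f.2 l (by simpa using hl)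
      have hlof (k : κ) : DirectSum.lof R P (fun d => coordGrading R q d) (q k)
          ⟨Pi.single k (f.1 k), single_mem_coordGrading q k _⟩ =
          DirectSum.lof R P (fun d => coordGrading R q d) d ⟨Pi.single k (f.1 k), hf k⟩ := by
        by_cases hk : f.1 k = 0
        · simp only [hk, Pi.single_zero]
          exact (map_zero _).trans (map_zero _).symm
        · obtain rfl := f.2 k hk
          rfl
      simp only [D, LinearMap.comp_apply, LinearMap.sum_apply, DirectSum.coeLinearMap_lof]
      refine (Finset.sum_congr rfl fun k _ => hlof k).trans ?_
      rw [← map_sum, LinearMap.id_apply]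
      congr 1
      ext1
      rw [AddSubmonoidClass.coe_finsetSum]
      exact LinearMap.sum_single_apply (fun _ => R) f.1)
  exact DirectSum.Decomposition.isInternal _

lemma IsGradedExtendedFrom.of_equiv {R P M : Type u} [CommRing R] {Q : Type} [AddCommMonoid Q]
    [AddCommGroup P] [DecidableEq P] (deg : Q →+ P) [AddCommGroup M] [Module R M]
    [Module (AddMonoidAlgebra R Q) M] [IsScalarTower R (AddMonoidAlgebra R Q) M]
    {ℳ : P → Submodule R M} {κ : Type} [Fintype κ] [DecidableEq κ] (q : κ → P)
    (e : M ≃ₗ[AddMonoidAlgebra R Q] (κ → AddMonoidAlgebra R Q))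
    (he : ∀ c, ∀ m ∈ ℳ c, ∀ k, e m k ∈ suppIn R {x | deg x = c - q k})
    (he' : ∀ c a, (∀ k, a k ∈ suppIn R {x | deg x = c - q k}) → e.symm a ∈ ℳ c) :
    IsGradedExtendedFrom R (monAlgGrading R deg) M ℳ := by
  let t := TensorProduct.piScalarRight R (AddMonoidAlgebra R Q) (AddMonoidAlgebra R Q) κ
  refine ⟨κ → R, inferInstance, inferInstance, coordGrading R q, isInternal_coordGrading q,
    inferInstance, inferInstance, e ≪≫ₗ t.symm, fun c m hm => ?_, fun c z hz => ?_⟩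
  · have : t.symm (e m) = ∑ k, e m k ⊗ₜ Pi.single k 1 := by
      rw [LinearEquiv.symm_apply_eq, map_sum]
      ext1 k
      simp [t, Finset.sum_apply, Pi.single_apply]
    rw [LinearEquiv.trans_apply, this]
    refine Submodule.sum_mem _ fun k _ => Submodule.subset_span
      ⟨c - q k, q k, sub_add_cancel _ _, _, ?_, _, single_mem_coordGrading q k 1, rfl⟩
    rw [monAlgGrading_eq_suppIn]
    exact he c m hm k
  · change e.symm (t z) ∈ ℳ c
    refine he' c _ fun k => ?_
    induction hz using Submodule.span_induction with
    | mem z hz =>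
      obtain ⟨a, b, rfl, x, hx, f, hf, rfl⟩ := hz
      rw [monAlgGrading_eq_suppIn] at hx
      rw [TensorProduct.piScalarRight_apply, TensorProduct.piScalarRightHom_tmul]
      by_cases hk : f k = 0
      · simp [hk]
      · rw [hf k hk, add_sub_cancel_right]
        exact Submodule.smul_mem _ _ hx
    | zero => simp
    | add y z _ _ hy hz =>
      rw [map_add]
      exact Submodule.add_mem _ hy hz
    | smul r z _ hz =>
      have htr : t (r • z) = r • t z := LinearMap.map_smul_of_tower t.toLinearMap r z
      rw [htr]
      exact Submodule.smul_mem _ _ hz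

/-!
STATEMENT 2 (Theorem `Main-2`(1)):
Let `R` be a regular commutative noetherian ring satisfying condition (††), `P` a
finitely generated abelian group, and let `A = R[x_1,…,x_n]` (realized as the monoid
algebra `R[ℕ^n]`) be a polynomial `R`-algebra, `P`-graded by letting `x_i` be
homogeneous of degree `λ i` and `R` of degree `0`.  Then every finitely generated
`P`-graded `A`-module which is projective as an `A`-module is isomorphic, as a
`P`-graded `A`-module, to `F ⊗_R A` for some `P`-graded `R`-module `F` which is
finitely generated and projective over `R`.
-/
theorem equivariant_bass_quillen_for_condDaggerDagger
    (R : Type u) [CommRing R] [IsNoetherianRing R]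
    (hreg : IsRegularRingP R) (hdd : CondDaggerDagger R)
    (P : Type u) [AddCommGroup P] [AddGroup.FG P] [DecidableEq P]
    (n : ℕ) (lam : Fin n → P)
    (M : Type u) [AddCommGroup M] [Module R M]
    [Module (AddMonoidAlgebra R (Fin n → ℕ)) M]
    [IsScalarTower R (AddMonoidAlgebra R (Fin n → ℕ)) M]
    (ℳ : P → Submodule R M)
    (hM : IsGradedModule
      (monAlgGrading R (fun m : Fin n → ℕ => ∑ i, (m i) • lam i)) ℳ)
    (hfin : Module.Finite (AddMonoidAlgebra R (Fin n → ℕ)) M)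
    (hproj : Module.Projective (AddMonoidAlgebra R (Fin n → ℕ)) M) :
    IsGradedExtendedFrom R
      (monAlgGrading R (fun m : Fin n → ℕ => ∑ i, (m i) • lam i)) M ℳ := by
  let A := AddMonoidAlgebra R (Fin n → ℕ)
  let deg : (Fin n → ℕ) →+ P :=
    { toFun := fun m => ∑ i, m i • lam i
      map_zero' := by simp
      map_add' := fun a b => by simp [add_smul, Finset.sum_add_distrib] }
  change IsGradedModule (monAlgGrading R deg) ℳ at hM
  change IsGradedExtendedFrom R (monAlgGrading R deg) M ℳ
  have hexp (d : P) : exponents lam Finset.univ d = {x | deg x = d} := by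
    ext x
    simp [exponents, deg]
  obtain ⟨N, p, g, hg, hspan⟩ := exists_homogeneous_generators hM.is_internal hfin
  let φ : (Fin N → A) →ₗ[A] M := Fintype.linearCombination A g
  have hφ : Function.Surjective φ := by
    rw [← LinearMap.range_eq_top, Fintype.range_linearCombination, hspan]
  obtain ⟨τ₀, hτ₀⟩ := Module.projective_lifting_property φ LinearMap.id hφ
  obtain ⟨τ, hτ, hτ_mem⟩ := exists_graded_section hM hg τ₀ fun m => LinearMap.congr_fun hτ₀ m
  replace hτ (m : M) : φ (τ m) = m := hτ m
  let E : Matrix (Fin N) (Fin N) A := LinearMap.toMatrix' (τ ∘ₗ φ)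
  have hE_mulVec (a : Fin N → A) : E.mulVec a = τ (φ a) := LinearMap.toMatrix'_mulVec _ a
  have hE : E * E = E := by
    refine Matrix.toLin'.injective (LinearMap.ext fun a => ?_)
    simp only [Matrix.toLin'_mul, LinearMap.comp_apply, Matrix.toLin'_apply, hE_mulVec, hτ]
  have hE_homog : E.IsHomog lam Finset.univ p p := fun i j => by
    rw [hexp]
    convert hτ_mem _ _ (hg j) i
    simp [E, LinearMap.toMatrix'_apply, φ]
  obtain ⟨κ, _, _, q, X, Y, hX, hY, hXY, hYX⟩ :=
    gradedSplits_of_idempotent hdd lam Finset.univ (Fin N) p E hE hE_homog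
  let e : M ≃ₗ[A] (κ → A) := LinearEquiv.ofLinearMap (Y.mulVecLin ∘ₗ τ) (φ ∘ₗ X.mulVecLin)
    (LinearMap.ext fun a => by
      simp only [LinearMap.comp_apply, Matrix.mulVecLin_apply, ← hE_mulVec, Matrix.mulVec_mulVec,
        ← hXY, LinearMap.id_apply]
      rw [← Matrix.mul_assoc, hYX, Matrix.one_mul, hYX, Matrix.one_mulVec])
    (LinearMap.ext fun m => by
      simp only [LinearMap.comp_apply, Matrix.mulVecLin_apply, Matrix.mulVec_mulVec, hXY,
        hE_mulVec, hτ, LinearMap.id_apply])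
  refine .of_equiv deg q e (fun c m hm k => ?_) fun c a ha => ?_
  · refine Submodule.sum_mem _ fun i _ => mul_mem_suppIn ?_ (hY k i) (hτ_mem c m hm i)
    rw [hexp]
    rintro x (hx : deg x = _) y (hy : deg y = _)
    rw [Set.mem_ofPred_eq, map_add, hx, hy]
    abel
  · change ∑ i, X.mulVec a i • g i ∈ ℳ c
    refine Submodule.sum_mem _ fun i _ => ?_
    have hXa : X.mulVec a i ∈ monAlgGrading R deg (c - p i) := by
      rw [monAlgGrading_eq_suppIn]
      refine Submodule.sum_mem _ fun k _ => mul_mem_suppIn ?_ (hX i k) (ha k)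
      rw [hexp]
      rintro x (hx : deg x = _) y (hy : deg y = _)
      rw [Set.mem_ofPred_eq, map_add, hx, hy]
      abel
    simpa using hM.smul_mem hXa (hg i)
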